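/- Let d ≥ 1 and n ≥ 1 be integers and let γ be a real number with 1 ≤ γ < 3/2. Let V : ℝ^d → M_n(ℂ) be a continuous function whose values are Hermitian nonpositive matrices, such that x ↦ tr((−V(x))^{γ+d/2}) is Lebesgue integrable on ℝ^d. Let ψ_1, …, ψ_N : ℝ^d → ℂ^n be twice continuously differentiable, square-integrable functions forming an orthonormal family in L²(ℝ^d, ℂ^n), and let E_1, …, E_N > 0 satisfy −Δψ_j + Vψ_j = −E_j ψ_j on ℝ^d for each j, where Δ = ∑_{k=1}^d ∂²/∂x_k² acts componentwise. Then ∑_{j=1}^N E_j^γ ≤ 2 L^cl_{γ,d} ∫_{ℝ^d} tr((−V(x))^{γ+d/2}) dx, where L^cl_{γ,d} := Γ(γ+1)/(2^d π^{d/2} Γ(γ + d/2 + 1)). -/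

import Mathlib

open MeasureTheory Matrix
open scoped ComplexOrder

/-- The classical Lieb–Thirring constant `L^cl_{γ,d} = Γ(γ+1)/(2^d π^{d/2} Γ(γ+d/2+1))`. -/
noncomputable def Lcl (γ : ℝ) (d : ℕ) : ℝ :=
  Real.Gamma (γ + 1) / (2 ^ d * Real.pi ^ ((d : ℝ) / 2) * Real.Gamma (γ + d / 2 + 1))

/-- For a Hermitian matrix `A` (whose eigenvalues are nonnegative in our applications)
this is the trace of the power `A^p` defined by the functional calculus:
`tr(A^p) = ∑ λ_i(A)^p`. -/
noncomputable def traceRpow {n : ℕ} (A : Matrix (Fin n) (Fin n) ℂ)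
    (hA : A.IsHermitian) (p : ℝ) : ℝ :=
  ∑ i, hA.eigenvalues i ^ p

/-- The Laplacian `Δf = ∑_{k=1}^d ∂²f/∂x_k²` of a function `f : ℝ^d → ℂ`. -/
noncomputable def lap {d : ℕ} (f : EuclideanSpace ℝ (Fin d) → ℂ)
    (x : EuclideanSpace ℝ (Fin d)) : ℂ :=
  ∑ k : Fin d,
    fderiv ℝ (fun y => fderiv ℝ f y (EuclideanSpace.single k (1 : ℝ))) x
      (EuclideanSpace.single k (1 : ℝ))

namespace LiebThirring

section MatrixInequalities

variable {ι : Type} [Fintype ι] [DecidableEq ι]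

lemma trace_eq_sum_star_dotProduct {κ : Type*} [Fintype κ]
    (b : OrthonormalBasis κ ℂ (EuclideanSpace ℂ ι)) (M : Matrix ι ι ℂ) :
    M.trace = ∑ k, star (b k).ofLp ⬝ᵥ (M *ᵥ (b k).ofLp) := by
  have h := LinearMap.trace_eq_sum_inner (Matrix.toEuclideanLin M) b
  rw [Matrix.toEuclideanLin_eq_toLin_orthonormal, Matrix.trace_toLin_eq] at h
  rw [h]
  refine Finset.sum_congr rfl fun k _ => ?_
  rw [← Matrix.toEuclideanLin_eq_toLin_orthonormal, EuclideanSpace.inner_eq_star_dotProduct,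
    dotProduct_comm]
  rfl

lemma star_dotProduct_eigenvectorBasis {A : Matrix ι ι ℂ} (hA : A.IsHermitian) (k l : ι) :
    star (hA.eigenvectorBasis k).ofLp ⬝ᵥ (hA.eigenvectorBasis l).ofLp = if k = l then 1 else 0 := by
  rw [← orthonormal_iff_ite.1 hA.eigenvectorBasis.orthonormal k l,
    EuclideanSpace.inner_eq_star_dotProduct, dotProduct_comm]

lemma pow_mulVec_eigenvectorBasis {A : Matrix ι ι ℂ} (hA : A.IsHermitian) (k : ι) (m : ℕ) :
    (A ^ m) *ᵥ (hA.eigenvectorBasis k).ofLp =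
      ((hA.eigenvalues k : ℂ) ^ m) • (hA.eigenvectorBasis k).ofLp := by
  induction m with
  | zero => simp
  | succ m ih =>
    rw [pow_succ, ← mulVec_mulVec, hA.mulVec_eigenvectorBasis]
    ext i
    have := congrFun ih i
    simp only [mulVec_smul, Pi.smul_apply] at this ⊢
    rw [this]
    simp [pow_succ]; ring

lemma re_trace_pow {A : Matrix ι ι ℂ} (hA : A.IsHermitian) (m : ℕ) :
    ((A ^ m).trace).re = ∑ k, hA.eigenvalues k ^ m := by
  rw [trace_eq_sum_star_dotProduct hA.eigenvectorBasis, Complex.re_sum]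
  refine Finset.sum_congr rfl fun k _ => ?_
  rw [pow_mulVec_eigenvectorBasis, dotProduct_smul, star_dotProduct_eigenvectorBasis]
  simp only [if_true, smul_eq_mul, mul_one]
  norm_cast

/-- Duality between a bound on the negative part of the form `B`, tested on families that are
orthonormal with respect to the form `A`, and a lower bound on the trace of `B`. -/
lemma ofReal_neg_trace_sub_le {A B : Matrix ι ι ℂ} (hA : A.PosSemidef) {p : ℝ} {m : ℕ}
    {α β : ℝ} {X : ENNReal} (hβ : 0 ≤ β) (hα : 0 ≤ α)
    (young : ∀ a f : ℝ, 0 ≤ a → 0 ≤ f → a * f ≤ α * a ^ m + β * f ^ p)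
    (hker : ∀ ξ : ι → ℂ, A *ᵥ ξ = 0 → (star ξ ⬝ᵥ (B *ᵥ ξ)).re = 0)
    (hX : ∀ (κ : Type) [Fintype κ] [DecidableEq κ] (ξ : κ → ι → ℂ),
      (∀ k l, star (ξ k) ⬝ᵥ (A *ᵥ ξ l) = if k = l then 1 else 0) →
      ENNReal.ofReal (∑ k, max (-(star (ξ k) ⬝ᵥ (B *ᵥ ξ k)).re) 0 ^ p) ≤ X) :
    ENNReal.ofReal (-(B.trace).re - α * ((A ^ m).trace).re) ≤ ENNReal.ofReal β * X := by
  set a := hA.1.eigenvalues with ha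
  set e := fun k => (hA.1.eigenvectorBasis k).ofLp with he
  have ha0 : ∀ k, 0 ≤ a k := hA.eigenvalues_nonneg
  have hAe : ∀ k, A *ᵥ e k = (a k : ℂ) • e k := fun k => by
    simpa using pow_mulVec_eigenvectorBasis hA.1 k 1
  let ξ : {k // 0 < a k} → ι → ℂ := fun k => ((Real.sqrt (a k))⁻¹ : ℂ) • e k
  have hξ : ∀ k l, star (ξ k) ⬝ᵥ (A *ᵥ ξ l) = if k = l then 1 else 0 := by
    intro k l
    have h1 := star_dotProduct_eigenvectorBasis hA.1 k l
    simp only [ξ, mulVec_smul, hAe, star_smul, smul_dotProduct, dotProduct_smul]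
    rw [h1]
    have hk : ((Real.sqrt (a k) : ℝ) : ℂ) * (Real.sqrt (a k) : ℝ) = (a k : ℝ) := by
      rw [← Complex.ofReal_mul, Real.mul_self_sqrt (ha0 k)]
    have hk0 : ((Real.sqrt (a k) : ℝ) : ℂ) ≠ 0 := by
      exact_mod_cast (Real.sqrt_pos.2 k.2).ne'
    by_cases hkl : k = l
    · subst hkl
      simp only [if_true, smul_eq_mul, mul_one, star_inv₀, ← hk]
      simp only [RCLike.star_def, Complex.conj_ofReal]
      field_simp
    · rw [if_neg (fun h => hkl (Subtype.ext h)), if_neg hkl]; simp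
  have key := hX _ ξ hξ
  have hB : ∀ k (hk : 0 < a k), (star (e k) ⬝ᵥ (B *ᵥ e k)).re =
      a k * (star (ξ ⟨k, hk⟩) ⬝ᵥ (B *ᵥ ξ ⟨k, hk⟩)).re := by
    intro k hk
    have hs : a k = Real.sqrt (a k) * Real.sqrt (a k) := (Real.mul_self_sqrt (ha0 k)).symm
    have hk0 : Real.sqrt (a k) ≠ 0 := (Real.sqrt_pos.2 hk).ne'
    simp only [ξ, mulVec_smul, star_smul, smul_dotProduct, dotProduct_smul]
    rw [← Complex.ofReal_inv]
    simp only [RCLike.star_def, Complex.conj_ofReal, smul_eq_mul, Complex.re_ofReal_mul]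
    generalize (star (e k) ⬝ᵥ B *ᵥ e k).re = r
    generalize Real.sqrt (a k) = s at hs hk0
    rw [hs]; field_simp
  have hB0 : ∀ k, ¬ 0 < a k → (star (e k) ⬝ᵥ (B *ᵥ e k)).re = 0 := by
    intro k hk
    refine hker _ ?_
    rw [hAe, le_antisymm (not_lt.1 hk) (ha0 k)]; simp
  have hmain : -(B.trace).re - α * ((A ^ m).trace).re ≤
      β * ∑ k, max (-(star (ξ k) ⬝ᵥ (B *ᵥ ξ k)).re) 0 ^ p := by
    rw [re_trace_pow hA.1, trace_eq_sum_star_dotProduct hA.1.eigenvectorBasis, Complex.re_sum,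
      ← Finset.sum_neg_distrib, Finset.mul_sum, Finset.mul_sum, ← Finset.sum_sub_distrib]
    rw [← Fintype.sum_subtype_add_sum_subtype (fun k => 0 < a k)]
    rw [← add_zero (∑ k : {k // 0 < a k}, _ * _)]
    refine add_le_add (Finset.sum_le_sum fun k _ => ?_) (Finset.sum_nonpos fun k _ => ?_)
    · have h1 := hB k k.2
      have h2 := young (a k) (max (-(star (ξ k) ⬝ᵥ (B *ᵥ ξ k)).re) 0) (ha0 k) (le_max_right _ _)
      have h3 : a k * -(star (ξ k) ⬝ᵥ (B *ᵥ ξ k)).re ≤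
        a k * max (-(star (ξ k) ⬝ᵥ (B *ᵥ ξ k)).re) 0 :=
          mul_le_mul_of_nonneg_left (le_max_left _ _) (ha0 k)
      simp only [he] at h1
      rw [h1]; linarith
    · have h1 := hB0 k k.2
      simp only [he] at h1
      rw [h1]
      have := mul_nonneg hα (pow_nonneg (ha0 k) m)
      linarith
  calc _ ≤ ENNReal.ofReal (β * ∑ k, max (-(star (ξ k) ⬝ᵥ (B *ᵥ ξ k)).re) 0 ^ p) :=
        ENNReal.ofReal_le_ofReal hmain
    _ = ENNReal.ofReal β * _ := ENNReal.ofReal_mul hβ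
    _ ≤ _ := by gcongr

lemma re_trace_mul_nonneg {A B : Matrix ι ι ℂ} (hA : A.PosSemidef)
    (hB : ∀ ξ : ι → ℂ, 0 ≤ (star ξ ⬝ᵥ (B *ᵥ ξ)).re) : 0 ≤ ((A * B).trace).re := by
  rw [trace_mul_comm, trace_eq_sum_star_dotProduct hA.1.eigenvectorBasis, Complex.re_sum]
  refine Finset.sum_nonneg fun k _ => ?_
  rw [← mulVec_mulVec]
  have hAe := pow_mulVec_eigenvectorBasis hA.1 k 1
  rw [pow_one, pow_one] at hAe
  rw [hAe, mulVec_smul, dotProduct_smul, smul_eq_mul, Complex.re_ofReal_mul]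
  exact mul_nonneg (hA.eigenvalues_nonneg k) (hB _)

lemma re_trace_pow_three_le {A T : Matrix ι ι ℂ} (hA : A.PosSemidef)
    (h : ∀ (ξ : ι → ℂ) (lam : ℝ), 0 < lam →
      2 * (star ξ ⬝ᵥ (A *ᵥ ξ)).re ≤ lam * (star ξ ⬝ᵥ ξ).re + lam⁻¹ * (star ξ ⬝ᵥ (T *ᵥ ξ)).re) :
    ((A ^ 3).trace).re ≤ ((A * T).trace).re := by
  rw [re_trace_pow hA.1, trace_mul_comm, trace_eq_sum_star_dotProduct hA.1.eigenvectorBasis,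
    Complex.re_sum]
  refine Finset.sum_le_sum fun k _ => ?_
  rw [← mulVec_mulVec]
  have hAe := pow_mulVec_eigenvectorBasis hA.1 k 1
  rw [pow_one, pow_one] at hAe
  rw [hAe, mulVec_smul, dotProduct_smul, smul_eq_mul, Complex.re_ofReal_mul]
  rcases (hA.eigenvalues_nonneg k).eq_or_lt with h0 | h0
  · rw [← h0]; simp
  · have h1 := h (hA.1.eigenvectorBasis k).ofLp _ h0
    rw [hAe, dotProduct_smul, star_dotProduct_eigenvectorBasis] at h1
    simp only [if_true, smul_eq_mul, mul_one, Complex.ofReal_re, Complex.one_re] at h1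
    set a := hA.1.eigenvalues k
    set t := (star (hA.1.eigenvectorBasis k).ofLp ⬝ᵥ T *ᵥ (hA.1.eigenvectorBasis k).ofLp).re
    have h2 : a ≤ a⁻¹ * t := by linarith
    have h3 : a ^ 2 ≤ t := by
      have := mul_le_mul_of_nonneg_left h2 h0.le
      rw [← mul_assoc, mul_inv_cancel₀ h0.ne', one_mul] at this
      nlinarith
    calc a ^ 3 = a * a ^ 2 := by ring
      _ ≤ _ := mul_le_mul_of_nonneg_left h3 h0.le

end MatrixInequalities

section OneDimensional

variable {ι : Type} [Fintype ι]

lemma sum_star_col_dotProduct (X M Y : Matrix ι ι ℂ) :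
    ∑ k, star (fun i => X i k) ⬝ᵥ (M *ᵥ fun i => Y i k) = (Xᴴ * M * Y).trace := by
  simp only [trace, diag, Matrix.mul_assoc]
  refine Finset.sum_congr rfl fun k _ => ?_
  rw [mul_apply]
  rfl

lemma hasDerivAt_matrix_mul {M N : ℝ → Matrix ι ι ℂ} {M' N' : Matrix ι ι ℂ} {t : ℝ}
    (hM : ∀ j k, HasDerivAt (fun t => M t j k) (M' j k) t)
    (hN : ∀ j k, HasDerivAt (fun t => N t j k) (N' j k) t) (j k : ι) :
    HasDerivAt (fun t => (M t * N t) j k) ((M' * N t + M t * N') j k) t := by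
  simp only [Matrix.add_apply, mul_apply, ← Finset.sum_add_distrib]
  exact HasDerivAt.fun_sum fun l _ => (hM j l).mul (hN l k)

lemma hasDerivAt_re_trace {M : ℝ → Matrix ι ι ℂ} {M' : Matrix ι ι ℂ} {t : ℝ}
    (hM : ∀ j k, HasDerivAt (fun t => M t j k) (M' j k) t) :
    HasDerivAt (fun t => (M t).trace.re) M'.trace.re t := by
  have h : HasDerivAt (fun t => (M t).trace) M'.trace t := by
    simp only [trace, diag]
    exact HasDerivAt.fun_sum fun l _ => hM l l
  exact Complex.reCLM.hasFDerivAt.comp_hasDerivAt t h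

lemma integral_eq_intervalIntegral {E : Type*} [NormedAddCommGroup E] [NormedSpace ℝ E]
    {f : ℝ → E} {R : ℝ} (hf : ∀ t, R ≤ |t| → f t = 0) :
    ∫ t in (-R)..R, f t = ∫ t, f t := by
  refine intervalIntegral.integral_eq_integral_of_support_subset fun t ht => ?_
  have : |t| < R := not_le.1 fun h => ht (hf t h)
  exact ⟨(abs_lt.1 this).1, (abs_lt.1 this).2.le⟩

lemma integrable_of_continuous_of_eq_zero {E : Type*} [NormedAddCommGroup E]
    {f : ℝ → E} {R : ℝ} (hc : Continuous f) (hf : ∀ t, R ≤ |t| → f t = 0) : Integrable f := by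
  refine hc.integrable_of_hasCompactSupport (HasCompactSupport.intro (isCompact_Icc (a := -R) (b := R))
    fun t ht => hf t ?_)
  by_contra h
  exact ht ⟨(abs_lt.1 (not_le.1 h)).1.le, (abs_lt.1 (not_le.1 h)).2.le⟩

/-- The matrices `A = Ψ*Ψ`, `K = Ψ*Ψ'`, `T = Ψ'*Ψ'` attached to a compactly supported
continuously differentiable curve `Ψ` of operators. -/
structure IsGramCurve (A K T : ℝ → Matrix ι ι ℂ) (R : ℝ) : Prop where
  nonneg : 0 ≤ R
  psd : ∀ t, (A t).PosSemidef
  contA : Continuous A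
  contK : Continuous K
  contT : Continuous T
  zeroA : ∀ t, R ≤ |t| → A t = 0
  zeroK : ∀ t, R ≤ |t| → K t = 0
  zeroT : ∀ t, R ≤ |t| → T t = 0
  deriv : ∀ t j k, HasDerivAt (fun t => A t j k) ((K t + (K t)ᴴ) j k) t
  block : ∀ t (ξ η : ι → ℂ), 0 ≤ (star ξ ⬝ᵥ (A t *ᵥ ξ)).re + 2 * (star ξ ⬝ᵥ (K t *ᵥ η)).re +
    (star η ⬝ᵥ (T t *ᵥ η)).re

variable {A K T : ℝ → Matrix ι ι ℂ} {R : ℝ}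

lemma IsGramCurve.block_trace [DecidableEq ι] (h : IsGramCurve A K T R) (t : ℝ) {G : Matrix ι ι ℂ}
    (hG : G.IsHermitian) :
    0 ≤ 4 * ((G * A t * G).trace).re + 2 * ((G * (K t + (K t)ᴴ)).trace).re + ((T t).trace).re := by
  have h1 : 0 ≤ ∑ k, ((star (fun i => ((2 : ℂ) • G) i k) ⬝ᵥ (A t *ᵥ fun i => ((2 : ℂ) • G) i k)).re +
      2 * (star (fun i => ((2 : ℂ) • G) i k) ⬝ᵥ (K t *ᵥ fun i => (1 : Matrix ι ι ℂ) i k)).re +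
      (star (fun i => (1 : Matrix ι ι ℂ) i k) ⬝ᵥ (T t *ᵥ fun i => (1 : Matrix ι ι ℂ) i k)).re) :=
    Finset.sum_nonneg fun k _ => h.block t _ _
  rw [Finset.sum_add_distrib, Finset.sum_add_distrib, ← Finset.mul_sum, ← Complex.re_sum,
    ← Complex.re_sum, ← Complex.re_sum, sum_star_col_dotProduct, sum_star_col_dotProduct,
    sum_star_col_dotProduct] at h1
  have h2 : ((G * (K t)ᴴ).trace).re = ((G * K t).trace).re := by
    rw [← Complex.conj_re, ← RCLike.star_def, ← trace_conjTranspose, conjTranspose_mul, hG.eq,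
      conjTranspose_conjTranspose, trace_mul_comm]
  rw [Matrix.mul_add, trace_add, Complex.add_re, h2]
  simp only [conjTranspose_smul, hG.eq, conjTranspose_one, Matrix.mul_one, Matrix.one_mul,
    Matrix.smul_mul, Matrix.mul_smul, trace_smul] at h1
  have h3 : star (2 : ℂ) = 2 := by simp
  rw [h3] at h1
  simp only [smul_eq_mul, Complex.mul_re, Complex.re_ofNat, Complex.im_ofNat, zero_mul,
    sub_zero] at h1
  linarith

lemma continuous_re_trace {X : Type*} [TopologicalSpace X] {M : X → Matrix ι ι ℂ}
    (hM : Continuous M) : Continuous fun t => ((M t).trace).re :=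
  Complex.continuous_re.comp hM.matrix_trace

lemma hasDerivAt_riccati_potential [DecidableEq ι] {G A : ℝ → Matrix ι ι ℂ} {A' : Matrix ι ι ℂ} {t : ℝ}
    (hG : ∀ j k, HasDerivAt (fun t => G t j k) (A t j k) t)
    (hA : ∀ j k, HasDerivAt (fun t => A t j k) (A' j k) t) :
    HasDerivAt (fun t => 4 / 3 * ((G t * G t * G t).trace).re + 2 * ((G t * A t).trace).re)
      (4 * ((G t * A t * G t).trace).re + 2 * ((G t * A').trace).re +
        2 * ((A t ^ 2).trace).re) t := by
  have hGG := hasDerivAt_matrix_mul (M := G) (N := G) hG hG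
  have hGGG := hasDerivAt_matrix_mul (M := fun t => G t * G t) (N := G) hGG hG
  have hGA := hasDerivAt_matrix_mul (M := G) (N := A) hG hA
  have h1 := (hasDerivAt_re_trace (M := fun t => G t * G t * G t) hGGG).const_mul (4 / 3 : ℝ)
  have h2 := (hasDerivAt_re_trace (M := fun t => G t * A t) hGA).const_mul (2 : ℝ)
  refine (h1.add h2).congr_deriv ?_
  have e1 : (A t * G t * G t).trace = (G t * A t * G t).trace := by
    rw [trace_mul_comm, ← Matrix.mul_assoc]
  have e2 : (G t * G t * A t).trace = (G t * A t * G t).trace := by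
    rw [Matrix.mul_assoc, trace_mul_comm]
  simp only [Matrix.add_mul, trace_add, Complex.add_re, e1, e2, pow_two]
  ring

/-- Sharp one-dimensional kinetic inequality dual to the Lieb–Thirring inequality with
exponent `3/2`. -/
lemma IsGramCurve.two_mul_integral_trace_sq_le [DecidableEq ι] (h : IsGramCurve A K T R)
    {Γ : Matrix ι ι ℂ} (hΓ : ∀ j k, ∫ t, A t j k = Γ j k) :
    2 * ∫ t, ((A t ^ 2).trace).re ≤ (∫ t, ((T t).trace).re) + 1 / 3 * ((Γ ^ 3).trace).re := by
  have hAc : ∀ j k, Continuous fun t => A t j k := fun j k => h.contA.matrix_elem j k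
  let G : ℝ → Matrix ι ι ℂ := fun t => of fun j k => (∫ s in (-R)..t, A s j k) - Γ j k / 2
  have hGd : ∀ t j k, HasDerivAt (fun t => G t j k) (A t j k) t := fun t j k => by
    have := (intervalIntegral.integral_hasDerivAt_right ((hAc j k).intervalIntegrable (-R) t)
      ((hAc j k).stronglyMeasurableAtFilter _ _) (hAc j k).continuousAt)
    simpa [G] using this.sub_const (Γ j k / 2)
  have hGc : Continuous G := continuous_matrix fun j k =>
    continuous_iff_continuousAt.2 fun t => (hGd t j k).continuousAt
  have hA'c : Continuous fun t => K t + (K t)ᴴ := h.contK.add h.contK.matrix_conjTranspose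
  have hconj : ∀ s j k, star (A s k j) = A s j k := fun s j k => (h.psd s).1.apply j k
  have hΓh : Γ.IsHermitian := by
    ext j k
    rw [conjTranspose_apply, ← hΓ, ← hΓ, RCLike.star_def, ← integral_conj]
    exact integral_congr_ae (Filter.Eventually.of_forall fun s => hconj s j k)
  have hGh : ∀ t, (G t).IsHermitian := fun t => by
    ext j k
    have h1 : star (∫ s in (-R)..t, A s k j) = ∫ s in (-R)..t, A s j k := by
      simp only [intervalIntegral, star_sub, RCLike.star_def, ← integral_conj]
      simp only [← RCLike.star_def, hconj]
    simp only [G, conjTranspose_apply, of_apply, star_sub, h1]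
    rw [← hΓh.apply j k]
    simp
  have hGR : G R = (1 / 2 : ℂ) • Γ := by
    ext j k
    simp only [G, of_apply, Matrix.smul_apply, smul_eq_mul]
    rw [integral_eq_intervalIntegral (fun t ht => by rw [h.zeroA t ht]; rfl), hΓ]
    ring
  have hGR' : G (-R) = (-(1 / 2) : ℂ) • Γ := by
    ext j k
    simp only [G, of_apply, Matrix.smul_apply, smul_eq_mul, intervalIntegral.integral_same]
    ring
  let H : ℝ → ℝ := fun t => 4 / 3 * ((G t * G t * G t).trace).re + 2 * ((G t * A t).trace).re
  let H' : ℝ → ℝ := fun t => 4 * ((G t * A t * G t).trace).re +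
    2 * ((G t * (K t + (K t)ᴴ)).trace).re + 2 * ((A t ^ 2).trace).re
  have hH : ∀ t, HasDerivAt H (H' t) t := fun t => by
    exact hasDerivAt_riccati_potential (A := A) (hGd t) (h.deriv t)
  have hH'c : Continuous H' := by
    refine ((continuous_const.mul (continuous_re_trace ?_)).add
      (continuous_const.mul (continuous_re_trace ?_))).add
      (continuous_const.mul (continuous_re_trace ?_))
    · exact (hGc.mul h.contA).mul hGc
    · exact hGc.mul hA'c
    · exact h.contA.pow 2
  have h_integrable := intervalIntegral.integral_eq_sub_of_hasDerivAt (fun t _ => hH t)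
    (hH'c.intervalIntegrable (-R) R)
  have hend : H R - H (-R) = 1 / 3 * ((Γ ^ 3).trace).re := by
    have a1 : A R = 0 := h.zeroA R (le_abs_self R)
    have a2 : A (-R) = 0 := h.zeroA (-R) (by rw [abs_neg]; exact le_abs_self R)
    have e3 : Γ ^ 3 = Γ * Γ * Γ := by rw [pow_succ, pow_two]
    simp only [H, a1, a2, hGR, hGR', Matrix.smul_mul, Matrix.mul_smul, trace_smul, ← e3, Matrix.mul_zero,
      trace_zero, smul_smul]
    have c1 : (1 / 2 * (1 / 2 * (1 / 2)) : ℂ) = ((1 / 8 : ℝ) : ℂ) := by push_cast; norm_num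
    have c2 : (-(1 / 2) * (-(1 / 2) * -(1 / 2)) : ℂ) = ((-(1 / 8) : ℝ) : ℂ) := by
      push_cast; norm_num
    simp only [c1, c2, smul_eq_mul, Complex.re_ofReal_mul, Complex.zero_re]
    ring
  have hA2 : ∫ t, ((A t ^ 2).trace).re = ∫ t in (-R)..R, ((A t ^ 2).trace).re :=
    (integral_eq_intervalIntegral fun t ht => by rw [h.zeroA t ht]; simp).symm
  have hTT : ∫ t, ((T t).trace).re = ∫ t in (-R)..R, ((T t).trace).re :=
    (integral_eq_intervalIntegral fun t ht => by rw [h.zeroT t ht]; simp).symm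
  have cA := continuous_re_trace (h.contA.pow 2)
  have cT := continuous_re_trace h.contT
  rw [hA2, hTT, ← hend, ← h_integrable, ← intervalIntegral.integral_const_mul,
    ← intervalIntegral.integral_add (cT.intervalIntegrable _ _) (hH'c.intervalIntegrable _ _)]
  refine intervalIntegral.integral_mono_on (by linarith [h.nonneg])
    ((continuous_const.mul cA).intervalIntegrable _ _) ((cT.add hH'c).intervalIntegrable _ _)
    fun t _ => ?_
  have := h.block_trace t (hGh t)
  simp only [H']
  linarith

end OneDimensional

section Agmon

variable {ι : Type} [Fintype ι] {A K T : ℝ → Matrix ι ι ℂ} {R : ℝ}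

lemma integral_re_dotProduct {X : Type*} [MeasurableSpace X] {ν : Measure X}
    {M : X → Matrix ι ι ℂ} {Γ : Matrix ι ι ℂ}
    (hM : ∀ j k, Integrable (fun t => M t j k) ν) (hΓ : ∀ j k, ∫ t, M t j k ∂ν = Γ j k)
    (ξ η : ι → ℂ) :
    ∫ t, (star ξ ⬝ᵥ (M t *ᵥ η)).re ∂ν = (star ξ ⬝ᵥ (Γ *ᵥ η)).re := by
  have h_integrable : ∀ j k, Integrable (fun t => star ξ j * (M t j k * η k)) ν := fun j k =>
    ((hM j k).mul_const _).const_mul _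
  have h : ∫ t, star ξ ⬝ᵥ (M t *ᵥ η) ∂ν = star ξ ⬝ᵥ (Γ *ᵥ η) := by
    simp only [dotProduct, mulVec, Finset.mul_sum]
    rw [integral_finsetSum _ fun j _ => integrable_finsetSum _ fun k _ => h_integrable j k]
    refine Finset.sum_congr rfl fun j _ => ?_
    rw [integral_finsetSum _ fun k _ => h_integrable j k]
    refine Finset.sum_congr rfl fun k _ => ?_
    rw [integral_const_mul, integral_mul_const, hΓ]
  rw [← h]
  refine integral_re (𝕜 := ℂ) ?_
  simp only [dotProduct, mulVec, Finset.mul_sum]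
  exact integrable_finsetSum _ fun j _ => integrable_finsetSum _ fun k _ => h_integrable j k

lemma integral_re_trace_mul {X : Type*} [MeasurableSpace X] {ν : Measure X}
    {M : X → Matrix ι ι ℂ} {Γ : Matrix ι ι ℂ}
    (hM : ∀ j k, Integrable (fun t => M t j k) ν) (hΓ : ∀ j k, ∫ t, M t j k ∂ν = Γ j k)
    (N : Matrix ι ι ℂ) :
    ∫ t, ((M t * N).trace).re ∂ν = ((Γ * N).trace).re := by
  have h_integrable : ∀ j k, Integrable (fun t => M t j k * N k j) ν := fun j k => (hM j k).mul_const _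
  have h : ∫ t, (M t * N).trace ∂ν = (Γ * N).trace := by
    simp only [trace, diag, mul_apply]
    rw [integral_finsetSum _ fun j _ => integrable_finsetSum _ fun k _ => h_integrable j k]
    refine Finset.sum_congr rfl fun j _ => ?_
    rw [integral_finsetSum _ fun k _ => h_integrable j k]
    refine Finset.sum_congr rfl fun k _ => ?_
    rw [integral_mul_const, hΓ]
  rw [← h]
  refine integral_re (𝕜 := ℂ) ?_
  simp only [trace, diag, mul_apply]
  exact integrable_finsetSum _ fun j _ => integrable_finsetSum _ fun k _ => h_integrable j k

lemma integral_re_trace [DecidableEq ι] {X : Type*} [MeasurableSpace X] {ν : Measure X}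
    {M : X → Matrix ι ι ℂ} {Γ : Matrix ι ι ℂ}
    (hM : ∀ j k, Integrable (fun t => M t j k) ν) (hΓ : ∀ j k, ∫ t, M t j k ∂ν = Γ j k) :
    ∫ t, ((M t).trace).re ∂ν = (Γ.trace).re := by
  simpa using integral_re_trace_mul hM hΓ 1

lemma IsGramCurve.integrable_A (h : IsGramCurve A K T R) (j k : ι) :
    Integrable fun t => A t j k :=
  integrable_of_continuous_of_eq_zero (h.contA.matrix_elem j k)
    fun t ht => by rw [h.zeroA t ht]; rfl

lemma IsGramCurve.integrable_T (h : IsGramCurve A K T R) (j k : ι) :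
    Integrable fun t => T t j k :=
  integrable_of_continuous_of_eq_zero (h.contT.matrix_elem j k)
    fun t ht => by rw [h.zeroT t ht]; rfl

lemma re_star_dotProduct_conjTranspose (M : Matrix ι ι ℂ) (ξ : ι → ℂ) :
    (star ξ ⬝ᵥ (Mᴴ *ᵥ ξ)).re = (star ξ ⬝ᵥ (M *ᵥ ξ)).re := by
  rw [← Complex.conj_re, ← RCLike.star_def, star_dotProduct, star_star, star_mulVec,
    conjTranspose_conjTranspose, ← dotProduct_mulVec]

/-- Operator-valued version of the inequality `|f(t)|² ≤ ‖f‖ ‖f'‖`. -/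
lemma IsGramCurve.agmon (h : IsGramCurve A K T R) {Γ S : Matrix ι ι ℂ}
    (hΓ : ∀ j k, ∫ t, A t j k = Γ j k) (hS : ∀ j k, ∫ t, T t j k = S j k)
    (t : ℝ) (ξ : ι → ℂ) {lam : ℝ} (hlam : 0 < lam) :
    2 * (star ξ ⬝ᵥ (A t *ᵥ ξ)).re ≤
      lam * (star ξ ⬝ᵥ (Γ *ᵥ ξ)).re + lam⁻¹ * (star ξ ⬝ᵥ (S *ᵥ ξ)).re := by
  have hdot : ∀ {M : ℝ → Matrix ι ι ℂ}, Continuous M →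
      Continuous fun t => (star ξ ⬝ᵥ (M t *ᵥ ξ)).re := fun hM =>
    Complex.continuous_re.comp (continuous_const.dotProduct (hM.matrix_mulVec continuous_const))
  let g : ℝ → ℝ := fun t => (star ξ ⬝ᵥ (A t *ᵥ ξ)).re
  let κ : ℝ → ℝ := fun t => 2 * (star ξ ⬝ᵥ (K t *ᵥ ξ)).re
  let b : ℝ → ℝ := fun t => lam * (star ξ ⬝ᵥ (A t *ᵥ ξ)).re + lam⁻¹ * (star ξ ⬝ᵥ (T t *ᵥ ξ)).re
  have hκc : Continuous κ := continuous_const.mul (hdot h.contK)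
  have hbc : Continuous b :=
    (continuous_const.mul (hdot h.contA)).add (continuous_const.mul (hdot h.contT))
  have hg : ∀ t, HasDerivAt g (κ t) t := fun t => by
    have h1 : HasDerivAt (fun t => star ξ ⬝ᵥ (A t *ᵥ ξ)) (star ξ ⬝ᵥ ((K t + (K t)ᴴ) *ᵥ ξ)) t := by
      simp only [dotProduct, mulVec]
      exact HasDerivAt.fun_sum fun j _ => (HasDerivAt.fun_sum fun k _ =>
        (h.deriv t j k).mul_const _).const_mul _
    refine (Complex.reCLM.hasFDerivAt.comp_hasDerivAt t h1).congr_deriv ?_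
    simp only [Complex.reCLM_apply, add_mulVec, dotProduct_add, Complex.add_re, κ,
      re_star_dotProduct_conjTranspose]
    ring
  have habs : ∀ t, |κ t| ≤ b t := by
    intro t
    have hc : Real.sqrt lam * Real.sqrt lam = lam := Real.mul_self_sqrt hlam.le
    have hc0 : Real.sqrt lam ≠ 0 := (Real.sqrt_pos.2 hlam).ne'
    have hb : ∀ σ : ℝ, σ * σ = 1 → 0 ≤ b t + σ * κ t := by
      intro σ hσ
      have := h.block t ((Real.sqrt lam : ℂ) • ξ) (((σ * (Real.sqrt lam)⁻¹ : ℝ) : ℂ) • ξ)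
      simp only [mulVec_smul, star_smul, smul_dotProduct, dotProduct_smul, RCLike.star_def,
        Complex.conj_ofReal, smul_eq_mul, Complex.re_ofReal_mul] at this
      have e1 : ∀ x : ℝ, Real.sqrt lam * (Real.sqrt lam * x) = lam * x := fun x => by
        rw [← mul_assoc, hc]
      have e2 : ∀ x : ℝ, (σ * (Real.sqrt lam)⁻¹) * ((σ * (Real.sqrt lam)⁻¹) * x) = lam⁻¹ * x :=
        fun x => by
          conv_rhs => rw [← hc, ← one_mul (_⁻¹), ← hσ]
          field_simp
      have e3 : ∀ x : ℝ, (σ * (Real.sqrt lam)⁻¹) * (Real.sqrt lam * x) = σ * x := fun x => by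
        field_simp
      simp only [e1, e2, e3] at this
      simp only [b, κ]
      linarith
    rw [abs_le]
    have h1 := hb 1 (by norm_num)
    have h2 := hb (-1) (by norm_num)
    constructor <;> linarith
  have hb0 : ∀ t, 0 ≤ b t := fun t => (abs_nonneg _).trans (habs t)
  have hIb : ∫ t, b t = lam * (star ξ ⬝ᵥ (Γ *ᵥ ξ)).re + lam⁻¹ * (star ξ ⬝ᵥ (S *ᵥ ξ)).re := by
    rw [integral_add, integral_const_mul, integral_const_mul,
      integral_re_dotProduct h.integrable_A hΓ, integral_re_dotProduct h.integrable_T hS]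
    · exact (integrable_of_continuous_of_eq_zero (hdot h.contA)
        fun t ht => by rw [h.zeroA t ht]; simp).const_mul _
    · exact (integrable_of_continuous_of_eq_zero (hdot h.contT)
        fun t ht => by rw [h.zeroT t ht]; simp).const_mul _
  rw [← hIb]
  by_cases ht : R ≤ |t|
  · rw [h.zeroA t ht]
    simpa using integral_nonneg hb0
  · have htR := abs_lt.1 (not_le.1 ht)
    have i1 := intervalIntegral.integral_eq_sub_of_hasDerivAt (fun t _ => hg t)
      (hκc.intervalIntegrable (-R) t)
    have i2 := intervalIntegral.integral_eq_sub_of_hasDerivAt (fun t _ => hg t)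
      (hκc.intervalIntegrable t R)
    have z1 : g (-R) = 0 := by
      simp only [g]; rw [h.zeroA (-R) (by rw [abs_neg]; exact le_abs_self R)]; simp
    have z2 : g R = 0 := by simp only [g]; rw [h.zeroA R (le_abs_self R)]; simp
    have j1 : ∫ s in (-R)..t, κ s ≤ ∫ s in (-R)..t, b s :=
      intervalIntegral.integral_mono_on htR.1.le (hκc.intervalIntegrable _ _)
        (hbc.intervalIntegrable _ _) fun s _ => (abs_le.1 (habs s)).2
    have j2 : -∫ s in t..R, κ s ≤ ∫ s in t..R, b s := by
      rw [← intervalIntegral.integral_neg]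
      exact intervalIntegral.integral_mono_on htR.2.le (hκc.neg.intervalIntegrable _ _)
        (hbc.intervalIntegrable _ _) fun s _ => by linarith [(abs_le.1 (habs s)).1]
    have j3 := intervalIntegral.integral_add_adjacent_intervals
      (hbc.intervalIntegrable (-R) t) (hbc.intervalIntegrable (μ := volume) t R)
    rw [integral_eq_intervalIntegral (f := b) (R := R) (fun s hs => by
      simp only [b]; rw [h.zeroA s hs, h.zeroT s hs]; simp)] at j3
    have : g t = (star ξ ⬝ᵥ (A t *ᵥ ξ)).re := rfl
    rw [← this]
    linarith

/-- One-dimensional kinetic inequality of Eden and Foias for operator-valued curves. -/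
lemma IsGramCurve.integral_trace_pow_three_le [DecidableEq ι] (h : IsGramCurve A K T R)
    {Γ : Matrix ι ι ℂ} (hΓ : ∀ j k, ∫ t, A t j k = Γ j k) (hΓ1 : (1 - Γ).PosSemidef) :
    ∫ t, ((A t ^ 3).trace).re ≤ ∫ t, ((T t).trace).re := by
  let S : Matrix ι ι ℂ := of fun j k => ∫ t, T t j k
  have hS : ∀ j k, ∫ t, T t j k = S j k := fun j k => rfl
  have hle : ∀ ξ : ι → ℂ, (star ξ ⬝ᵥ (Γ *ᵥ ξ)).re ≤ (star ξ ⬝ᵥ ξ).re := fun ξ => by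
    have := hΓ1.re_dotProduct_nonneg ξ
    simp only [sub_mulVec, one_mulVec, dotProduct_sub, RCLike.re_to_complex, Complex.sub_re] at this
    linarith
  have hS0 : ∀ ξ : ι → ℂ, 0 ≤ (star ξ ⬝ᵥ (S *ᵥ ξ)).re := fun ξ => by
    rw [← integral_re_dotProduct h.integrable_T hS]
    refine integral_nonneg fun t => ?_
    simpa using h.block t 0 ξ
  have h1 : ∫ t, ((A t ^ 3).trace).re ≤ ∫ t, ((A t * S).trace).re := by
    refine integral_mono ?_ ?_ fun t => re_trace_pow_three_le (h.psd t) fun ξ lam hlam => ?_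
    · exact integrable_of_continuous_of_eq_zero (continuous_re_trace (h.contA.pow 3))
        fun t ht => by rw [h.zeroA t ht]; simp
    · exact integrable_of_continuous_of_eq_zero
        (continuous_re_trace (h.contA.mul continuous_const))
        fun t ht => by rw [h.zeroA t ht]; simp
    · refine (h.agmon hΓ hS t ξ hlam).trans ?_
      exact add_le_add (mul_le_mul_of_nonneg_left (hle ξ) hlam.le) le_rfl
  rw [integral_re_trace_mul h.integrable_A hΓ] at h1
  rw [integral_re_trace h.integrable_T hS]
  have h2 := re_trace_mul_nonneg hΓ1 hS0
  rw [Matrix.sub_mul, Matrix.one_mul, trace_sub, Complex.sub_re] at h2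
  linarith

end Agmon

section Slices

variable {d : ℕ} {E : Type*} [NormedAddCommGroup E]

lemma continuous_finCons : Continuous fun z : ℝ × (Fin d → ℝ) => (Fin.cons z.1 z.2 : Fin (d + 1) → ℝ) :=
  continuous_pi fun i => Fin.cases (by simpa using continuous_fst)
    (fun l => by simp only [Fin.cons_succ]; fun_prop) i

lemma abs_le_norm_finCons (t : ℝ) (y : Fin d → ℝ) : |t| ≤ ‖(Fin.cons t y : Fin (d + 1) → ℝ)‖ := by
  simpa using norm_le_pi_norm (Fin.cons t y : Fin (d + 1) → ℝ) 0

lemma norm_le_norm_finCons (t : ℝ) (y : Fin d → ℝ) : ‖y‖ ≤ ‖(Fin.cons t y : Fin (d + 1) → ℝ)‖ :=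
  (pi_norm_le_iff_of_nonneg (norm_nonneg _)).2 fun l => by
    simpa using norm_le_pi_norm (Fin.cons t y : Fin (d + 1) → ℝ) l.succ

lemma measurePreserving_finCons :
    MeasurePreserving (fun z : ℝ × (Fin d → ℝ) => (Fin.cons z.1 z.2 : Fin (d + 1) → ℝ)) := by
  have h := (volume_preserving_piFinSuccAbove (fun _ : Fin (d + 1) => ℝ) 0).symm
  convert h using 1
  ext z i
  simp [MeasurableEquiv.piFinSuccAbove]

lemma measurableEmbedding_finCons :
    MeasurableEmbedding (fun z : ℝ × (Fin d → ℝ) => (Fin.cons z.1 z.2 : Fin (d + 1) → ℝ)) := by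
  have h := (MeasurableEquiv.piFinSuccAbove (fun _ : Fin (d + 1) => ℝ) 0).symm.measurableEmbedding
  convert h using 1
  ext z i
  simp [MeasurableEquiv.piFinSuccAbove]

lemma lintegral_finCons {f : (Fin (d + 1) → ℝ) → ENNReal} (hf : Measurable f) :
    ∫⁻ x, f x = ∫⁻ t, ∫⁻ y : Fin d → ℝ, f (Fin.cons t y) := by
  rw [← measurePreserving_finCons.lintegral_comp hf, Measure.volume_eq_prod]
  exact lintegral_prod (fun z : ℝ × (Fin d → ℝ) => f (Fin.cons z.1 z.2))
    (hf.comp continuous_finCons.measurable).aemeasurable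

lemma integrable_of_continuous_of_norm {X : Type*} [NormedAddCommGroup X] [ProperSpace X]
    [MeasurableSpace X] [BorelSpace X] {ν : Measure X} [IsFiniteMeasureOnCompacts ν]
    {f : X → E} {R : ℝ}
    (hc : Continuous f) (hf : ∀ x, R ≤ ‖x‖ → f x = 0) : Integrable f ν :=
  hc.integrable_of_hasCompactSupport (HasCompactSupport.intro (isCompact_closedBall 0 R)
    fun x hx => hf x (by simpa using le_of_lt (by simpa using hx)))

variable {f f' : (Fin (d + 1) → ℝ) → E} {R : ℝ}

lemma continuous_slice (hc : Continuous f) (t : ℝ) :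
    Continuous fun y : Fin d → ℝ => f (Fin.cons t y) :=
  hc.comp (continuous_finCons.comp (continuous_const.prodMk continuous_id))

lemma slice_eq_zero (hf : ∀ x, R ≤ ‖x‖ → f x = 0) (t : ℝ) (y : Fin d → ℝ) (hy : R ≤ ‖y‖) :
    f (Fin.cons t y) = 0 := hf _ (hy.trans (norm_le_norm_finCons t y))

lemma integrable_slice (hc : Continuous f) (hf : ∀ x, R ≤ ‖x‖ → f x = 0) (t : ℝ) :
    Integrable fun y : Fin d → ℝ => f (Fin.cons t y) :=
  integrable_of_continuous_of_norm (continuous_slice hc t) (slice_eq_zero hf t)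

variable [NormedSpace ℝ E]

lemma integral_finCons (hc : Continuous f) (hf : ∀ x, R ≤ ‖x‖ → f x = 0) :
    ∫ t, ∫ y : Fin d → ℝ, f (Fin.cons t y) = ∫ x, f x := by
  have h1 : Integrable fun z : ℝ × (Fin d → ℝ) => f (Fin.cons z.1 z.2) :=
    (measurePreserving_finCons.integrable_comp_emb measurableEmbedding_finCons).2
      (integrable_of_continuous_of_norm hc hf)
  rw [← measurePreserving_finCons.integral_comp measurableEmbedding_finCons,
    Measure.volume_eq_prod, integral_prod _ h1]

lemma continuous_integral_slice (hc : Continuous f) (hf : ∀ x, R ≤ ‖x‖ → f x = 0) :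
    Continuous fun t => ∫ y : Fin d → ℝ, f (Fin.cons t y) := by
  rw [← continuousOn_univ]
  refine continuousOn_integral_of_compact_support (isCompact_closedBall (0 : Fin d → ℝ) R)
    (hc.comp continuous_finCons).continuousOn fun t y _ hy => ?_
  exact slice_eq_zero hf t y (by simpa using le_of_lt (by simpa using hy))

lemma integral_slice_eq_zero (hf : ∀ x, R ≤ ‖x‖ → f x = 0) (t : ℝ) (ht : R ≤ |t|) :
    ∫ y : Fin d → ℝ, f (Fin.cons t y) = 0 := by
  simp [fun y : Fin d → ℝ => hf (Fin.cons t y) (ht.trans (abs_le_norm_finCons t y))]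

lemma hasDerivAt_integral_slice (hc : Continuous f) (hf : ∀ x, R ≤ ‖x‖ → f x = 0)
    (hc' : Continuous f') (hf' : ∀ x, R ≤ ‖x‖ → f' x = 0)
    (hd : ∀ t (y : Fin d → ℝ), HasDerivAt (fun t => f (Fin.cons t y)) (f' (Fin.cons t y)) t)
    (t : ℝ) :
    HasDerivAt (fun t => ∫ y : Fin d → ℝ, f (Fin.cons t y)) (∫ y : Fin d → ℝ, f' (Fin.cons t y)) t := by
  obtain ⟨C, hC⟩ : ∃ C, ∀ x, ‖f' x‖ ≤ C := by
    refine hc'.bounded_above_of_compact_support (HasCompactSupport.intro (isCompact_closedBall 0 R)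
      fun x hx => hf' x (by simpa using le_of_lt (by simpa using hx)))
  refine (hasDerivAt_integral_of_dominated_loc_of_deriv_le (s := Set.univ)
    (bound := (Metric.closedBall (0 : Fin d → ℝ) R).indicator fun _ => C) Filter.univ_mem
    (Filter.Eventually.of_forall fun s => (integrable_slice hc hf s).aestronglyMeasurable)
    (integrable_slice hc hf t) (integrable_slice hc' hf' t).aestronglyMeasurable
    (Filter.Eventually.of_forall fun y s _ => ?_) ?_
    (Filter.Eventually.of_forall fun y s _ => hd s y)).2
  · by_cases hy : y ∈ Metric.closedBall (0 : Fin d → ℝ) R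
    · rw [Set.indicator_of_mem hy]; exact hC _
    · rw [Set.indicator_of_notMem hy,
        slice_eq_zero hf' s y (by simpa using le_of_lt (by simpa using hy))]
      simp
  · exact (integrable_indicator_iff measurableSet_closedBall).2
      (integrableOn_const (hs := (isCompact_closedBall _ _).measure_lt_top.ne))

end Slices

section TestFunctions

variable {d : ℕ} {F : Type*} [NormedAddCommGroup F] [InnerProductSpace ℂ F]

/-- The partial derivative in the `l`-th coordinate direction. -/
noncomputable def pd (l : Fin d) (u : (Fin d → ℝ) → F) (x : Fin d → ℝ) : F :=
  lineDeriv ℝ u x (Pi.single l 1)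

lemma pd_eq_fderiv {u : (Fin d → ℝ) → F} (hu : ContDiff ℝ 1 u) (l : Fin d) (x : Fin d → ℝ) :
    pd l u x = fderiv ℝ u x (Pi.single l 1) :=
  (hu.differentiable one_ne_zero x).lineDeriv_eq_fderiv

lemma continuous_pd {u : (Fin d → ℝ) → F} (hu : ContDiff ℝ 1 u) (l : Fin d) :
    Continuous (pd l u) := by
  rw [funext (pd_eq_fderiv hu l)]
  exact (hu.continuous_fderiv one_ne_zero).clm_apply continuous_const

lemma pd_slice (u : (Fin (d + 1) → ℝ) → F) (l : Fin d) (t : ℝ) (y : Fin d → ℝ) :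
    pd l (fun y => u (Fin.cons t y)) y = pd l.succ u (Fin.cons t y) := by
  unfold pd lineDeriv
  congr 1
  funext s
  refine congrArg u (funext fun i => ?_)
  refine Fin.cases ?_ (fun i => ?_) i
  · simp
  · simp [Pi.single_apply, Fin.succ_inj]

lemma contDiff_slice {u : (Fin (d + 1) → ℝ) → F} (hu : ContDiff ℝ 1 u) (t : ℝ) :
    ContDiff ℝ 1 fun y : Fin d → ℝ => u (Fin.cons t y) :=
  hu.comp (contDiff_pi.2 fun i => by
    refine Fin.cases ?_ (fun i => ?_) i
    · simpa using contDiff_const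
    · simpa using contDiff_apply ℝ ℝ i)

lemma hasDerivAt_slice {u : (Fin (d + 1) → ℝ) → F} (hu : ContDiff ℝ 1 u) (t : ℝ)
    (y : Fin d → ℝ) :
    HasDerivAt (fun t => u (Fin.cons t y)) (pd 0 u (Fin.cons t y)) t := by
  rw [pd_eq_fderiv hu]
  have h1 : HasDerivAt (fun t : ℝ => (Fin.cons t y : Fin (d + 1) → ℝ)) (Pi.single 0 1) t := by
    refine hasDerivAt_pi.2 fun i => ?_
    refine Fin.cases ?_ (fun i => ?_) i
    · simpa using hasDerivAt_id' t
    · simpa [Pi.single_apply] using hasDerivAt_const t (y i)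
  exact (hu.differentiable one_ne_zero _).hasFDerivAt.comp_hasDerivAt t h1

/-- Continuously differentiable functions supported, with their first derivatives, in the open
ball of radius `R`. -/
structure IsTest (R : ℝ) (u : (Fin d → ℝ) → F) : Prop where
  nonneg : 0 ≤ R
  contDiff : ContDiff ℝ 1 u
  eq_zero : ∀ x, R ≤ ‖x‖ → u x = 0
  pd_eq_zero : ∀ l x, R ≤ ‖x‖ → pd l u x = 0

lemma IsTest.slice {R : ℝ} {u : (Fin (d + 1) → ℝ) → F} (hu : IsTest R u) (t : ℝ) :
    IsTest R fun y : Fin d → ℝ => u (Fin.cons t y) where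
  nonneg := hu.nonneg
  contDiff := contDiff_slice hu.contDiff t
  eq_zero := slice_eq_zero hu.eq_zero t
  pd_eq_zero l x hx := by
    rw [pd_slice]; exact slice_eq_zero (hu.pd_eq_zero l.succ) t x hx

variable {ι : Type*} [Fintype ι]

lemma pd_sum_smul {u : ι → (Fin d → ℝ) → F} (hu : ∀ j, ContDiff ℝ 1 (u j)) (c : ι → ℂ)
    (l : Fin d) (x : Fin d → ℝ) :
    pd l (fun x => ∑ j, c j • u j x) x = ∑ j, c j • pd l (u j) x := by
  have h (j) : HasFDerivAt (fun x => c j • u j x) (c j • fderiv ℝ (u j) x) x :=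
    ((hu j).differentiable one_ne_zero x).hasFDerivAt.const_smul (c j)
  have h2 : HasFDerivAt (fun x => ∑ j, c j • u j x) (∑ j, c j • fderiv ℝ (u j) x) x :=
    HasFDerivAt.fun_sum fun j _ => h j
  rw [pd, h2.differentiableAt.lineDeriv_eq_fderiv, h2.fderiv]
  simp [pd_eq_fderiv (hu _)]

lemma IsTest.sum_smul {R : ℝ} (hR : 0 ≤ R) {u : ι → (Fin d → ℝ) → F} (hu : ∀ j, IsTest R (u j))
    (c : ι → ℂ) : IsTest R fun x => ∑ j, c j • u j x where
  nonneg := hR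
  contDiff := ContDiff.sum fun j _ => (hu j).contDiff.const_smul (c j)
  eq_zero x hx := by simp [fun j => (hu j).eq_zero x hx]
  pd_eq_zero l x hx := by
    rw [pd_sum_smul fun j => (hu j).contDiff]; simp [fun j => (hu j).pd_eq_zero l x hx]

section Gram

variable {X : Type*} [MeasurableSpace X] (ν : Measure X)

/-- The matrix of mutual `L²` inner products of two finite families of functions. -/
noncomputable def gram (f g : ι → X → F) : Matrix ι ι ℂ :=
  Matrix.of fun j k => ∫ x, inner ℂ (f j x) (g k x) ∂ν

variable {ν} {f g : ι → X → F}

omit [Fintype ι] in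
lemma gram_conjTranspose : (gram ν f g)ᴴ = gram ν g f := by
  ext j k
  simp only [gram, conjTranspose_apply, of_apply, RCLike.star_def, ← integral_conj, inner_conj_symm]

lemma star_dotProduct_gram_mulVec
    (h : ∀ j k, Integrable (fun x => inner ℂ (f j x) (g k x)) ν) (ξ η : ι → ℂ) :
    star ξ ⬝ᵥ (gram ν f g *ᵥ η) =
      ∫ x, inner ℂ (∑ j, ξ j • f j x) (∑ k, η k • g k x) ∂ν := by
  have e (x) : inner ℂ (∑ j, ξ j • f j x) (∑ k, η k • g k x) =
      ∑ j, ∑ k, (starRingEnd ℂ) (ξ j) * (η k * inner ℂ (f j x) (g k x)) := by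
    simp_rw [sum_inner, inner_sum, inner_smul_left, inner_smul_right]
  simp_rw [e]
  rw [integral_finsetSum _ fun j _ => integrable_finsetSum _ fun k _ =>
    ((h j k).const_mul _).const_mul _]
  simp only [dotProduct, mulVec, gram, of_apply, Pi.star_apply, RCLike.star_def]
  refine Finset.sum_congr rfl fun j _ => ?_
  rw [integral_finsetSum _ fun k _ => ((h j k).const_mul _).const_mul _, Finset.mul_sum]
  refine Finset.sum_congr rfl fun k _ => ?_
  rw [integral_const_mul, integral_const_mul]
  ring

end Gram

end TestFunctions

section Energy

variable {d : ℕ} {F : Type*} [NormedAddCommGroup F] [InnerProductSpace ℂ F]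

/-- The quadratic form `∫ |∇u|² - ⟨u, U u⟩` of the Schrödinger operator `-Δ - U`. -/
noncomputable def energy (U : (Fin d → ℝ) → F →L[ℂ] F) (u : (Fin d → ℝ) → F) : ℝ :=
  ∫ x, (∑ l, ‖pd l u x‖ ^ 2 - (inner ℂ (u x) (U x (u x))).re)

/-- A continuous potential `U`, diagonalized pointwise with eigenvalues `μ`. -/
structure IsWell {κ : Type*} [Fintype κ] (U : (Fin d → ℝ) → F →L[ℂ] F)
    (μ : (Fin d → ℝ) → κ → ℝ) : Prop where
  cont : Continuous U
  eig : ∀ x, ∃ b : OrthonormalBasis κ ℂ F, ∀ k, U x (b k) = (μ x k : ℂ) • b k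
  meas : ∀ s p : ℝ, 0 < p → Measurable fun x => ∑ k, max (μ x k - s) 0 ^ p

lemma IsWell.slice {κ : Type*} [Fintype κ] {U : (Fin (d + 1) → ℝ) → F →L[ℂ] F}
    {μ : (Fin (d + 1) → ℝ) → κ → ℝ} (h : IsWell U μ) (t : ℝ) :
    IsWell (fun y : Fin d → ℝ => U (Fin.cons t y)) (fun y => μ (Fin.cons t y)) where
  cont := continuous_slice h.cont t
  eig _ := h.eig _
  meas s p hp := (h.meas s p hp).comp
    (continuous_finCons.comp (continuous_const.prodMk continuous_id)).measurable

/-- The Lieb–Thirring inequality of order `p` with constant `L` in dimension `d`, for all shifted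
potentials `U - s` and compactly supported orthonormal families. -/
def LTBound (F κ : Type*) [NormedAddCommGroup F] [InnerProductSpace ℂ F] [Fintype κ]
    (d : ℕ) (p L : ℝ) : Prop :=
  ∀ (U : (Fin d → ℝ) → F →L[ℂ] F) (μ : (Fin d → ℝ) → κ → ℝ), IsWell U μ → ∀ s : ℝ, 0 ≤ s →
    ∀ (ι : Type) [Fintype ι] [DecidableEq ι] (R : ℝ) (u : ι → (Fin d → ℝ) → F),
      (∀ j, IsTest R (u j)) → gram volume u u = 1 →
      ENNReal.ofReal (∑ j, max (-energy U (u j) - s) 0 ^ p) ≤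
        ENNReal.ofReal L * ∫⁻ x, ENNReal.ofReal (∑ k, max (μ x k - s) 0 ^ (p + d / 2))

variable {U : (Fin (d + 1) → ℝ) → F →L[ℂ] F} {R : ℝ} {ι : Type}
  {f g : ι → (Fin (d + 1) → ℝ) → F}

/-- The matrices of inner products over the slices `{t} × ℝ^d`. -/
noncomputable def sliceGram (f g : ι → (Fin (d + 1) → ℝ) → F) (t : ℝ) : Matrix ι ι ℂ :=
  gram (volume : Measure (Fin d → ℝ)) (fun j y => f j (Fin.cons t y)) fun j y => g j (Fin.cons t y)

lemma continuous_sliceGram (hf : ∀ j, Continuous (f j)) (hg : ∀ j, Continuous (g j))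
    (h0 : ∀ j x, R ≤ ‖x‖ → f j x = 0) : Continuous (sliceGram f g) :=
  continuous_matrix fun j k => continuous_integral_slice (R := R)
    (f := fun x => inner ℂ (f j x) (g k x)) ((hf j).inner (hg k)) fun x hx => by simp [h0 j x hx]

lemma sliceGram_eq_zero (h0 : ∀ j x, R ≤ ‖x‖ → f j x = 0) (t : ℝ) (ht : R ≤ |t|) :
    sliceGram f g t = 0 := by
  ext j k
  exact integral_slice_eq_zero (f := fun x => inner ℂ (f j x) (g k x))
    (fun x hx => by simp [h0 j x hx]) t ht

lemma integral_sliceGram (hf : ∀ j, Continuous (f j)) (hg : ∀ j, Continuous (g j))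
    (h0 : ∀ j x, R ≤ ‖x‖ → f j x = 0) (j k : ι) :
    ∫ t, sliceGram f g t j k = gram volume f g j k :=
  integral_finCons (R := R) (f := fun x => inner ℂ (f j x) (g k x)) ((hf j).inner (hg k))
    fun x hx => by simp [h0 j x hx]

lemma star_dotProduct_sliceGram_mulVec [Fintype ι] (hf : ∀ j, Continuous (f j))
    (hg : ∀ j, Continuous (g j)) (h0 : ∀ j x, R ≤ ‖x‖ → f j x = 0) (t : ℝ) (ξ η : ι → ℂ) :
    star ξ ⬝ᵥ (sliceGram f g t *ᵥ η) = ∫ y : Fin d → ℝ,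
      inner ℂ (∑ j, ξ j • f j (Fin.cons t y)) (∑ k, η k • g k (Fin.cons t y)) :=
  star_dotProduct_gram_mulVec (fun j k => integrable_slice (R := R)
    (f := fun x => inner ℂ (f j x) (g k x)) ((hf j).inner (hg k))
    (fun x hx => by simp [h0 j x hx]) t) ξ η

variable {u : ι → (Fin (d + 1) → ℝ) → F}

lemma isGramCurve_sliceGram [Fintype ι] (hR : 0 ≤ R) (hu : ∀ j, IsTest R (u j)) :
    IsGramCurve (sliceGram u u) (sliceGram u fun j => pd 0 (u j))
      (sliceGram (fun j => pd 0 (u j)) fun j => pd 0 (u j)) R := by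
  have c0 (j : ι) := (hu j).contDiff.continuous
  have c1 (j : ι) := continuous_pd (hu j).contDiff 0
  have z0 (j : ι) := (hu j).eq_zero
  have z1 (j : ι) := (hu j).pd_eq_zero 0
  refine ⟨hR, fun t => ?_, continuous_sliceGram c0 c0 z0, continuous_sliceGram c0 c1 z0,
    continuous_sliceGram c1 c1 z1, sliceGram_eq_zero z0, sliceGram_eq_zero z0,
    sliceGram_eq_zero z1, fun t j k => ?_, fun t ξ η => ?_⟩
  · refine PosSemidef.of_dotProduct_mulVec_nonneg gram_conjTranspose fun ξ => ?_
    rw [star_dotProduct_sliceGram_mulVec c0 c0 z0]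
    simp_rw [inner_self_eq_norm_sq_to_K]
    norm_cast
    exact Complex.zero_le_real.2 (integral_nonneg fun y => by positivity)
  · have h := hasDerivAt_integral_slice (R := R) (f := fun x => inner ℂ (u j x) (u k x))
      (f' := fun x => inner ℂ (u j x) (pd 0 (u k) x) + inner ℂ (pd 0 (u j) x) (u k x))
      ((c0 j).inner (c0 k)) (fun x hx => by simp [z0 j x hx])
      (((c0 j).inner (c1 k)).add ((c1 j).inner (c0 k)))
      (fun x hx => by simp [z0 j x hx, z1 j x hx])
      (fun t y => (hasDerivAt_slice (hu j).contDiff t y).inner ℂ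
        (hasDerivAt_slice (hu k).contDiff t y)) t
    rw [integral_add (integrable_slice (R := R) (f := fun x => inner ℂ (u j x) (pd 0 (u k) x))
        ((c0 j).inner (c1 k)) (fun x hx => by simp [z0 j x hx]) t)
      (integrable_slice (R := R) (f := fun x => inner ℂ (pd 0 (u j) x) (u k x))
        ((c1 j).inner (c0 k)) (fun x hx => by simp [z1 j x hx]) t)] at h
    simp only [sliceGram, gram_conjTranspose]
    exact h
  · have c01 (v : ι → (Fin (d + 1) → ℝ) → F) (hv : ∀ j, Continuous (v j)) (ζ : ι → ℂ) :
        Continuous fun x => ∑ j, ζ j • v j x :=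
      continuous_finsetSum _ fun j _ => (hv j).const_smul (ζ j)
    have i (v w : (Fin (d + 1) → ℝ) → F) (hv : Continuous v) (hw : Continuous w)
        (h0 : ∀ x, R ≤ ‖x‖ → v x = 0) :
        Integrable fun y : Fin d → ℝ => (inner ℂ (v (Fin.cons t y)) (w (Fin.cons t y)) : ℂ) :=
      integrable_slice (R := R) (f := fun x => inner ℂ (v x) (w x)) (hv.inner hw)
        (fun x hx => by simp [h0 x hx]) t
    have i0 := i _ _ (c01 u c0 ξ) (c01 u c0 ξ) fun x hx => by simp [fun j => z0 j x hx]
    have i1 := i _ _ (c01 u c0 ξ) (c01 _ c1 η) fun x hx => by simp [fun j => z0 j x hx]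
    have i2 := i _ _ (c01 _ c1 η) (c01 _ c1 η) fun x hx => by simp [fun j => z1 j x hx]
    rw [star_dotProduct_sliceGram_mulVec c0 c0 z0, star_dotProduct_sliceGram_mulVec c0 c1 z0,
      star_dotProduct_sliceGram_mulVec c1 c1 z1]
    simp only [← RCLike.re_eq_complex_re]
    rw [← integral_re i0, ← integral_re i1, ← integral_re i2, ← integral_const_mul]
    refine (integral_nonneg fun y => ?_).trans_eq
      ((integral_add (i0.re.add (i1.re.const_mul 2)) i2.re).trans
        (congrArg (· + _) (integral_add i0.re (i1.re.const_mul 2))))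
    have := norm_add_sq (𝕜 := ℂ) (∑ j, ξ j • u j (Fin.cons t y))
      (∑ j, η j • pd 0 (u j) (Fin.cons t y))
    simp only [Pi.zero_apply, Pi.add_apply, inner_self_eq_norm_sq, ← this]
    positivity

end Energy

section SlicePotential

variable {d : ℕ} {F : Type*} [NormedAddCommGroup F] [InnerProductSpace ℂ F] {R : ℝ}

lemma IsTest.integrable_norm_sq_pd {u : (Fin d → ℝ) → F} (hu : IsTest R u) (l : Fin d) :
    Integrable fun x => ‖pd l u x‖ ^ 2 :=
  integrable_of_continuous_of_norm (R := R) ((continuous_pd hu.contDiff l).norm.pow 2)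
    fun x hx => by simp [hu.pd_eq_zero l x hx]

lemma IsTest.integrable_norm_sq {u : (Fin d → ℝ) → F} (hu : IsTest R u) :
    Integrable fun x => ‖u x‖ ^ 2 :=
  integrable_of_continuous_of_norm (R := R) (hu.contDiff.continuous.norm.pow 2)
    fun x hx => by simp [hu.eq_zero x hx]

lemma IsTest.integrable_inner {u : (Fin d → ℝ) → F} {U : (Fin d → ℝ) → F →L[ℂ] F}
    (hu : IsTest R u) (hU : Continuous U) : Integrable fun x => (inner ℂ (u x) (U x (u x)) : ℂ) :=
  integrable_of_continuous_of_norm (R := R)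
    (hu.contDiff.continuous.inner (hU.clm_apply hu.contDiff.continuous))
    fun x hx => by simp [hu.eq_zero x hx]

lemma IsTest.energy_eq {u : (Fin d → ℝ) → F} {U : (Fin d → ℝ) → F →L[ℂ] F}
    (hu : IsTest R u) (hU : Continuous U) :
    energy U u = ∑ l, (∫ x, ‖pd l u x‖ ^ 2) - (∫ x, inner ℂ (u x) (U x (u x))).re := by
  rw [energy, integral_sub 
    (f := fun x => ∑ l, ‖pd l u x‖ ^ 2) (g := fun x => (inner ℂ (u x) (U x (u x))).re)
    (integrable_finsetSum _ fun l _ => hu.integrable_norm_sq_pd l)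
    (hu.integrable_inner hU).re, integral_finsetSum _ fun l _ => hu.integrable_norm_sq_pd l]
  congr 1
  exact integral_re (hu.integrable_inner hU)

lemma re_integral_inner_self {X : Type*} [MeasurableSpace X] {ν : Measure X} (w : X → F) :
    (∫ x, inner ℂ (w x) (w x) ∂ν).re = ∫ x, ‖w x‖ ^ 2 ∂ν := by
  simp_rw [inner_self_eq_norm_sq_to_K]
  norm_cast

variable {U : (Fin (d + 1) → ℝ) → F →L[ℂ] F} {ι : Type} {u : ι → (Fin (d + 1) → ℝ) → F}

/-- The matrices of the energy form of the sliced Schrödinger operators. -/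
noncomputable def sliceEnergy (U : (Fin (d + 1) → ℝ) → F →L[ℂ] F)
    (u : ι → (Fin (d + 1) → ℝ) → F) (t : ℝ) : Matrix ι ι ℂ :=
  ∑ l : Fin d, sliceGram (fun j => pd l.succ (u j)) (fun j => pd l.succ (u j)) t -
    sliceGram u (fun j x => U x (u j x)) t

lemma continuous_sliceEnergy (hu : ∀ j, IsTest R (u j)) (hU : Continuous U) :
    Continuous (sliceEnergy U u) :=
  (continuous_finsetSum _ fun l _ => continuous_sliceGram
    (fun j => continuous_pd (hu j).contDiff l.succ) (fun j => continuous_pd (hu j).contDiff l.succ)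
    fun j => (hu j).pd_eq_zero l.succ).sub
  (continuous_sliceGram (fun j => (hu j).contDiff.continuous)
    (fun j => hU.clm_apply (hu j).contDiff.continuous) fun j => (hu j).eq_zero)

lemma sliceEnergy_eq_zero (hu : ∀ j, IsTest R (u j)) (t : ℝ) (ht : R ≤ |t|) :
    sliceEnergy U u t = 0 := by
  rw [sliceEnergy, sliceGram_eq_zero (fun j => (hu j).eq_zero) t ht]
  rw [sub_zero]
  exact Finset.sum_eq_zero fun l _ => sliceGram_eq_zero (fun j => (hu j).pd_eq_zero l.succ) t ht

variable [Fintype ι]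

lemma re_star_dotProduct_sliceEnergy_mulVec (hR : 0 ≤ R) (hu : ∀ j, IsTest R (u j))
    (hU : Continuous U) (t : ℝ) (ξ : ι → ℂ) :
    (star ξ ⬝ᵥ (sliceEnergy U u t *ᵥ ξ)).re =
      energy (fun y => U (Fin.cons t y)) fun y => ∑ j, ξ j • u j (Fin.cons t y) := by
  have c1 (l) (j : ι) := continuous_pd (hu j).contDiff l
  rw [(IsTest.sum_smul (u := fun j y => u j (Fin.cons t y)) hR (fun j => (hu j).slice t) ξ).energy_eq (continuous_slice hU t),
    sliceEnergy, sub_mulVec, dotProduct_sub, Complex.sub_re, sum_mulVec, dotProduct_sum,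
    Complex.re_sum, star_dotProduct_sliceGram_mulVec (fun j => (hu j).contDiff.continuous)
      (fun j => hU.clm_apply (hu j).contDiff.continuous) fun j => (hu j).eq_zero]
  congr 1
  · refine Finset.sum_congr rfl fun l _ => ?_
    rw [star_dotProduct_sliceGram_mulVec (c1 l.succ) (c1 l.succ) (fun j => (hu j).pd_eq_zero l.succ),
      re_integral_inner_self]
    simp_rw [pd_sum_smul (fun j => ((hu j).slice t).contDiff), pd_slice]
  · simp only [map_sum, map_smul]

lemma sum_energy_eq (hu : ∀ j, IsTest R (u j)) (hU : Continuous U) :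
    ∑ j, energy U (u j) =
      (∫ t, ((sliceGram (fun j => pd 0 (u j)) (fun j => pd 0 (u j)) t).trace).re) +
      ∫ t, ((sliceEnergy U u t).trace).re := by
  have c1 (l) (j : ι) := continuous_pd (hu j).contDiff l
  classical
  have iT (l : Fin (d + 1)) (j k : ι) :
      Integrable fun t => sliceGram (fun j => pd l (u j)) (fun j => pd l (u j)) t j k :=
    integrable_of_continuous_of_eq_zero (R := R)
      ((continuous_sliceGram (c1 l) (c1 l) fun j => (hu j).pd_eq_zero l).matrix_elem j k)
      fun t ht => by rw [sliceGram_eq_zero (fun j => (hu j).pd_eq_zero l) t ht]; rfl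
  have iV (j k : ι) : Integrable fun t => sliceGram u (fun j x => U x (u j x)) t j k :=
    integrable_of_continuous_of_eq_zero (R := R)
      ((continuous_sliceGram (fun j => (hu j).contDiff.continuous)
        (fun j => hU.clm_apply (hu j).contDiff.continuous)
        fun j => (hu j).eq_zero).matrix_elem j k)
      fun t ht => by rw [sliceGram_eq_zero (fun j => (hu j).eq_zero) t ht]; rfl
  have eB (j k : ι) : ∫ t, sliceEnergy U u t j k =
      (∑ l : Fin d, gram volume (fun j => pd l.succ (u j)) (fun j => pd l.succ (u j)) -
        gram volume u (fun j x => U x (u j x))) j k := by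
    simp only [sliceEnergy, Matrix.sub_apply, Matrix.sum_apply]
    rw [integral_sub (integrable_finsetSum Finset.univ fun (l : Fin d) _ => iT l.succ j k) (iV j k),
      integral_finsetSum _ fun (l : Fin d) _ => iT l.succ j k,
      integral_sliceGram (fun j => (hu j).contDiff.continuous)
        (fun j => hU.clm_apply (hu j).contDiff.continuous) (fun j => (hu j).eq_zero)]
    simp_rw [integral_sliceGram (c1 _) (c1 _) (fun j => (hu j).pd_eq_zero _)]
  rw [integral_re_trace (fun j k => iT 0 j k)
      (integral_sliceGram (c1 0) (c1 0) fun j => (hu j).pd_eq_zero 0),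
    integral_re_trace (fun j k => integrable_of_continuous_of_eq_zero (R := R)
      ((continuous_sliceEnergy hu hU).matrix_elem j k) fun t ht => by
        rw [sliceEnergy_eq_zero hu t ht]; rfl) eB]
  simp only [trace, diag_apply, Complex.re_sum, Matrix.sub_apply, Matrix.sum_apply, Complex.sub_re, gram,
    of_apply, re_integral_inner_self, ← Finset.sum_add_distrib]
  refine Finset.sum_congr rfl fun j _ => ?_
  rw [(hu j).energy_eq hU, Fin.sum_univ_succ]
  ring

end SlicePotential

lemma ofReal_integral_le_lintegral {X : Type*} [MeasurableSpace X] {ν : Measure X} {f : X → ℝ}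
    (hf : Integrable f ν) : ENNReal.ofReal (∫ x, f x ∂ν) ≤ ∫⁻ x, ENNReal.ofReal (f x) ∂ν := by
  have h := ofReal_integral_eq_lintegral_ofReal hf.pos_part
    (Filter.Eventually.of_forall fun x => le_max_right _ _)
  calc ENNReal.ofReal (∫ x, f x ∂ν) ≤ ENNReal.ofReal (∫ x, max (f x) 0 ∂ν) :=
        ENNReal.ofReal_le_ofReal (integral_mono hf hf.pos_part fun x => le_max_left _ _)
    _ = ∫⁻ x, ENNReal.ofReal (max (f x) 0) ∂ν := h
    _ = ∫⁻ x, ENNReal.ofReal (f x) ∂ν := by simp [ENNReal.ofReal_max]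

section Lifting

variable {d : ℕ} {F κ : Type*} [NormedAddCommGroup F] [InnerProductSpace ℂ F] [Fintype κ]
  {R s p L α β : ℝ} {m : ℕ} {U : (Fin (d + 1) → ℝ) → F →L[ℂ] F} {μ : (Fin (d + 1) → ℝ) → κ → ℝ}
  {ι : Type} [Fintype ι] [DecidableEq ι] {u : ι → (Fin (d + 1) → ℝ) → F}

lemma energy_zero (U : (Fin d → ℝ) → F →L[ℂ] F) : energy U (fun _ => (0 : F)) = 0 := by
  simp [energy, pd, lineDeriv]

lemma ofReal_slice_le (hLT : LTBound F κ d p L) (hU : IsWell U μ) (hs : 0 ≤ s) (hR : 0 ≤ R)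
    (hu : ∀ j, IsTest R (u j)) (hβ : 0 ≤ β) (hα : 0 ≤ α)
    (young : ∀ a f : ℝ, 0 ≤ a → 0 ≤ f → a * f ≤ α * a ^ m + β * f ^ p) (t : ℝ) :
    ENNReal.ofReal (-((sliceEnergy U u t + (s : ℂ) • sliceGram u u t).trace).re -
      α * ((sliceGram u u t ^ m).trace).re) ≤
    ENNReal.ofReal β * (ENNReal.ofReal L * ∫⁻ y : Fin d → ℝ,
      ENNReal.ofReal (∑ k, max (μ (Fin.cons t y) k - s) 0 ^ (p + d / 2))) := by
  have c0 (j) := (hu j).contDiff.continuous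
  have z0 (j) := (hu j).eq_zero
  have eA (ξ η : ι → ℂ) := star_dotProduct_sliceGram_mulVec c0 c0 z0 t ξ η
  have eB (ξ : ι → ℂ) : (star ξ ⬝ᵥ ((sliceEnergy U u t + (s : ℂ) • sliceGram u u t) *ᵥ ξ)).re =
      energy (fun y => U (Fin.cons t y)) (fun y => ∑ j, ξ j • u j (Fin.cons t y)) +
        s * (star ξ ⬝ᵥ (sliceGram u u t *ᵥ ξ)).re := by
    rw [add_mulVec, dotProduct_add, Complex.add_re,
      re_star_dotProduct_sliceEnergy_mulVec hR hu hU.cont, smul_mulVec, dotProduct_smul,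
      smul_eq_mul, Complex.re_ofReal_mul]
  have hw (ξ : ι → ℂ) : IsTest R fun y : Fin d → ℝ => ∑ j, ξ j • u j (Fin.cons t y) :=
    IsTest.sum_smul (u := fun j y => u j (Fin.cons t y)) hR (fun j => (hu j).slice t) ξ
  refine ofReal_neg_trace_sub_le ((isGramCurve_sliceGram hR hu).psd t) hβ hα young
    (fun ξ hξ => ?_) fun κ' _ _ ξ hξ => ?_
  · have h0 : ∫ y : Fin d → ℝ, ‖∑ j, ξ j • u j (Fin.cons t y)‖ ^ 2 = 0 := by
      rw [← re_integral_inner_self, ← eA, hξ]; simp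
    have h1 : (fun y : Fin d → ℝ => ‖∑ j, ξ j • u j (Fin.cons t y)‖ ^ 2) = 0 := by
      rw [integral_eq_zero_iff_of_nonneg (fun y => by positivity) (hw ξ).integrable_norm_sq] at h0
      exact (Continuous.ae_eq_iff_eq volume ((hw ξ).contDiff.continuous.norm.pow 2)
        continuous_zero).1 h0
    have h2 : (fun y : Fin d → ℝ => ∑ j, ξ j • u j (Fin.cons t y)) = fun _ => 0 :=
      funext fun y => by simpa using congrFun h1 y
    rw [eB, h2, energy_zero, hξ]; simp
  · have hg : gram volume (fun k (y : Fin d → ℝ) => ∑ j, ξ k j • u j (Fin.cons t y))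
        (fun k (y : Fin d → ℝ) => ∑ j, ξ k j • u j (Fin.cons t y)) = 1 := by
      ext k l
      rw [one_apply, ← hξ k l, eA]; rfl
    have := hLT _ _ (hU.slice t) s hs κ' R _ (fun k => hw (ξ k)) hg
    refine le_trans (le_of_eq ?_) this
    congr 1
    refine Finset.sum_congr rfl fun k _ => ?_
    rw [eB, hξ k k, if_pos rfl, Complex.one_re, mul_one, neg_add']

lemma ofReal_integral_slice_le (hp : 0 < p) (hLT : LTBound F κ d p L) (hU : IsWell U μ)
    (hs : 0 ≤ s) (hR : 0 ≤ R) (hm : m ≠ 0)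
    (hu : ∀ j, IsTest R (u j)) (hβ : 0 ≤ β) (hα : 0 ≤ α)
    (young : ∀ a f : ℝ, 0 ≤ a → 0 ≤ f → a * f ≤ α * a ^ m + β * f ^ p) :
    ENNReal.ofReal (-(∫ t, ((sliceEnergy U u t).trace).re) - s * ((gram volume u u).trace).re -
      α * ∫ t, ((sliceGram u u t ^ m).trace).re) ≤
    ENNReal.ofReal β * (ENNReal.ofReal L * ∫⁻ x,
      ENNReal.ofReal (∑ k, max (μ x k - s) 0 ^ (p + d / 2))) := by
  have c0 (j) := (hu j).contDiff.continuous
  have z0 (j) := (hu j).eq_zero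
  have hA := isGramCurve_sliceGram hR hu
  have iB : Integrable fun t => ((sliceEnergy U u t).trace).re :=
    integrable_of_continuous_of_eq_zero (R := R)
      (continuous_re_trace (continuous_sliceEnergy hu hU.cont)) fun t ht => by
        simp [sliceEnergy_eq_zero hu t ht]
  have iA : Integrable fun t => ((sliceGram u u t).trace).re :=
    integrable_of_continuous_of_eq_zero (R := R)
      (continuous_re_trace hA.contA) fun t ht => by simp [hA.zeroA t ht]
  have iM : Integrable fun t => ((sliceGram u u t ^ m).trace).re :=
    integrable_of_continuous_of_eq_zero (R := R)
      (continuous_re_trace (hA.contA.pow m)) fun t ht => by simp [hA.zeroA t ht, hm]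
  have hmeas : Measurable fun x => ENNReal.ofReal (∑ k, max (μ x k - s) 0 ^ (p + d / 2)) :=
    (hU.meas s _ (by positivity)).ennreal_ofReal
  have e : -(∫ t, ((sliceEnergy U u t).trace).re) - s * ((gram volume u u).trace).re -
      α * ∫ t, ((sliceGram u u t ^ m).trace).re =
      ∫ t, (-((sliceEnergy U u t + (s : ℂ) • sliceGram u u t).trace).re -
        α * ((sliceGram u u t ^ m).trace).re) := by
    rw [← integral_re_trace hA.integrable_A (integral_sliceGram c0 c0 z0)]
    simp only [trace_add, trace_smul, Complex.add_re, smul_eq_mul, Complex.re_ofReal_mul]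
    have h1 := integral_add iB (iA.const_mul s)
    have h2 := integral_sub (iB.add (iA.const_mul s)).neg (iM.const_mul α)
    simp only [Pi.neg_apply, Pi.add_apply, integral_neg] at h2
    rw [h2, h1, integral_const_mul, integral_const_mul]
    ring
  rw [e]
  refine (ofReal_integral_le_lintegral ?_).trans
    ((lintegral_mono fun t => ofReal_slice_le hLT hU hs hR hu hβ hα young t).trans_eq ?_)
  · simp only [trace_add, trace_smul, Complex.add_re, smul_eq_mul, Complex.re_ofReal_mul]
    exact (iB.add (iA.const_mul s)).neg.sub (iM.const_mul α)
  · rw [lintegral_finCons hmeas, lintegral_const_mul' _ _ ENNReal.ofReal_ne_top,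
      lintegral_const_mul' _ _ ENNReal.ofReal_ne_top]

end Lifting

section Weights

variable {d : ℕ} {F : Type*} [NormedAddCommGroup F] [InnerProductSpace ℂ F] {R : ℝ}

lemma pd_smul {u : (Fin d → ℝ) → F} (hu : ContDiff ℝ 1 u) (c : ℂ) (l : Fin d) (x : Fin d → ℝ) :
    pd l (fun x => c • u x) x = c • pd l u x := by
  simpa using pd_sum_smul (ι := Unit) (u := fun _ => u) (fun _ => hu) (fun _ => c) l x

lemma IsTest.smul {u : (Fin d → ℝ) → F} (hu : IsTest R u) (c : ℂ) : IsTest R fun x => c • u x := by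
  simpa using IsTest.sum_smul (ι := Unit) (u := fun _ => u) hu.nonneg (fun _ => hu) (fun _ => c)

lemma energy_smul {u : (Fin d → ℝ) → F} (hu : ContDiff ℝ 1 u) (U : (Fin d → ℝ) → F →L[ℂ] F)
    (c : ℝ) : energy U (fun x => (c : ℂ) • u x) = c ^ 2 * energy U u := by
  rw [energy, energy, ← integral_const_mul]
  congr 1
  funext x
  simp only [pd_smul hu, norm_smul, map_smul, inner_smul_left, inner_smul_right, mul_pow,
    ← Finset.mul_sum, Complex.norm_real, Real.norm_eq_abs, sq_abs, Complex.conj_ofReal,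
    Complex.re_ofReal_mul]
  ring

lemma gram_smul {ι X : Type*} [MeasurableSpace X] {ν : Measure X} (u : ι → X → F) (c : ι → ℝ)
    (j k : ι) : gram ν (fun j x => (c j : ℂ) • u j x) (fun j x => (c j : ℂ) • u j x) j k =
      c j * gram ν u u j k * c k := by
  simp only [gram, of_apply, inner_smul_left, inner_smul_right, integral_const_mul,
    Complex.conj_ofReal]
  ring

end Weights

section Lifting

variable {d : ℕ} {F κ : Type*} [NormedAddCommGroup F] [InnerProductSpace ℂ F] [Fintype κ] {L : ℝ}

lemma mul_le_two_mul_sq_add (a f : ℝ) : a * f ≤ 2 * a ^ 2 + 1 / 8 * f ^ (2 : ℝ) := by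
  rw [Real.rpow_two]
  nlinarith [sq_nonneg (4 * a - f)]

lemma mul_le_pow_three_add {a f : ℝ} (ha : 0 ≤ a) (hf : 0 ≤ f) :
    a * f ≤ 1 * a ^ 3 + 2 / (3 * √3) * f ^ (3 / 2 : ℝ) := by
  have h3 : √3 ^ 2 = (3 : ℝ) := Real.sq_sqrt (by norm_num)
  have h3' : 0 < √(3 : ℝ) := by positivity
  have hff : f ^ (3 / 2 : ℝ) = √f ^ 3 := by
    rw [Real.sqrt_eq_rpow, ← Real.rpow_natCast, ← Real.rpow_mul hf]; norm_num
  obtain ⟨h, hh, e⟩ : ∃ h, 0 ≤ h ∧ √f = √3 * h :=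
    ⟨√f / √3, by positivity, by field_simp⟩
  have hf2 : f = 3 * h ^ 2 := by rw [← Real.sq_sqrt hf, e, mul_pow, h3]
  have e3 : 2 / (3 * √3) * √f ^ 3 = 2 * h ^ 3 := by
    rw [e]; field_simp; rw [h3]
  rw [hff, e3, hf2]
  nlinarith [mul_nonneg (sq_nonneg (a - h)) (by positivity : 0 ≤ a + 2 * h)]

/-- The operator-valued one-dimensional Lieb–Thirring inequality of order `3/2` raises the
dimension by one. -/
lemma LTBound.lift_three_halves (hLT : LTBound F κ d 2 L) :
    LTBound F κ (d + 1) (3 / 2) (3 / 16 * L) := by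
  intro U μ hU s hs ι _ _ R v hv hvv
  rcases isEmpty_or_nonempty ι with hι | ⟨⟨i0⟩⟩
  · simp
  have hR := (hv i0).nonneg
  set m : ι → ℝ := fun j => max (-energy U (v j) - s) 0 with hm
  have m0 (j) : 0 ≤ m j := le_max_right _ _
  set c : ι → ℝ := fun j => √√(m j) with hc
  have c2 (j) : c j ^ 2 = √(m j) := Real.sq_sqrt (Real.sqrt_nonneg _)
  have hu (j) : IsTest R fun x => (c j : ℂ) • v j x := (hv j).smul _
  have hΓ : gram volume (fun j x => (c j : ℂ) • v j x) (fun j x => (c j : ℂ) • v j x) =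
      diagonal fun j => ((√(m j) : ℝ) : ℂ) := by
    ext j k
    rw [gram_smul, hvv, one_apply, diagonal_apply]
    split_ifs with h
    · rw [← h, mul_one, ← Complex.ofReal_mul, ← sq, c2]
    · simp
  have key := ofReal_integral_slice_le two_pos hLT hU hs hR two_ne_zero hu (β := 1 / 8) (α := 2)
    (by norm_num) two_pos.le fun a f _ _ => mul_le_two_mul_sq_add a f
  have h1 := (isGramCurve_sliceGram hR hu).two_mul_integral_trace_sq_le
    (integral_sliceGram (fun j => (hu j).contDiff.continuous)
      (fun j => (hu j).contDiff.continuous) fun j => (hu j).eq_zero)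
  have h2 := sum_energy_eq hu hU.cont
  simp only [fun j => energy_smul (hv j).contDiff U (c j), c2] at h2
  rw [hΓ, diagonal_pow] at h1
  rw [hΓ] at key
  simp only [trace_diagonal, Complex.re_sum, Complex.ofReal_re, Pi.pow_apply,
    ← Complex.ofReal_pow] at h1 key
  have e (j) : 2 / 3 * m j ^ (3 / 2 : ℝ) =
      -(√(m j) * energy U (v j)) - s * √(m j) - 1 / 3 * √(m j) ^ 3 := by
    have h3 : m j ^ (3 / 2 : ℝ) = √(m j) ^ 3 := by
      rw [Real.sqrt_eq_rpow, ← Real.rpow_natCast, ← Real.rpow_mul (m0 j)]; norm_num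
    rcases le_total (-energy U (v j) - s) 0 with h | h
    · have : m j = 0 := max_eq_right h
      rw [h3, this]; simp
    · have hmj : m j = -energy U (v j) - s := max_eq_left h
      have := Real.sq_sqrt (m0 j)
      rw [h3]
      linear_combination √(m j) * this + √(m j) * hmj
  have h4 := (ENNReal.ofReal_le_ofReal (p := 2 / 3 * ∑ j, m j ^ (3 / 2 : ℝ)) (by
    rw [Finset.mul_sum, Finset.sum_congr rfl fun j _ => e j, Finset.sum_sub_distrib,
      Finset.sum_sub_distrib, Finset.sum_neg_distrib, ← Finset.mul_sum, ← Finset.mul_sum]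
    linarith)).trans key
  have e5 : ∑ j, m j ^ (3 / 2 : ℝ) = 3 / 2 * (2 / 3 * ∑ j, m j ^ (3 / 2 : ℝ)) := by ring
  rw [e5, ENNReal.ofReal_mul (by norm_num)]
  refine (mul_le_mul_right h4 _).trans_eq ?_
  rw [← mul_assoc, ← mul_assoc, ← ENNReal.ofReal_mul (by norm_num),
    ← ENNReal.ofReal_mul (by norm_num)]
  congr 2
  · ring
  · ext x
    congr! 3
    push_cast; ring

/-- The Lieb–Thirring inequality of order one for families satisfying Bessel's inequality. -/
lemma LTBound.lift_one (hLT : LTBound F κ d (3 / 2) L)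
    {U : (Fin (d + 1) → ℝ) → F →L[ℂ] F} {μ : (Fin (d + 1) → ℝ) → κ → ℝ} (hU : IsWell U μ)
    {s : ℝ} (hs : 0 ≤ s) {ι : Type} [Fintype ι] [DecidableEq ι] {R : ℝ}
    {v : ι → (Fin (d + 1) → ℝ) → F} (hv : ∀ j, IsTest R (v j))
    (hvv : (1 - gram volume v v).PosSemidef) :
    ENNReal.ofReal (∑ j, max (-energy U (v j) - s) 0) ≤ ENNReal.ofReal (2 / (3 * √3) * L) *
      ∫⁻ x, ENNReal.ofReal (∑ k, max (μ x k - s) 0 ^ (1 + ((d + 1 : ℕ) : ℝ) / 2)) := by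
  rcases isEmpty_or_nonempty ι with hι | ⟨⟨i0⟩⟩
  · simp
  have hR := (hv i0).nonneg
  set c : ι → ℝ := fun j => if 0 ≤ -energy U (v j) - s then 1 else 0 with hc
  have c2 (j) : c j ^ 2 = c j := by simp only [hc]; split_ifs <;> simp
  have hu (j) : IsTest R fun x => (c j : ℂ) • v j x := (hv j).smul _
  set Γ := gram volume v v with hΓ
  have hΓ' : gram volume (fun j x => (c j : ℂ) • v j x) (fun j x => (c j : ℂ) • v j x) =
      diagonal (fun j => (c j : ℂ)) * Γ * diagonal fun j => (c j : ℂ) := by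
    ext j k
    rw [gram_smul, mul_diagonal, diagonal_mul]
  have hD : (diagonal fun j => (c j : ℂ))ᴴ = diagonal fun j => (c j : ℂ) := by
    rw [diagonal_conjTranspose]; congr 1; ext j; simp
  have hΓ1 : (1 - gram volume (fun j x => (c j : ℂ) • v j x)
      (fun j x => (c j : ℂ) • v j x)).PosSemidef := by
    have e : 1 - gram volume (fun j x => (c j : ℂ) • v j x) (fun j x => (c j : ℂ) • v j x) =
        diagonal (fun j => (c j : ℂ)) * (1 - Γ) * (diagonal fun j => (c j : ℂ))ᴴ +
          diagonal fun j => ((1 - c j : ℝ) : ℂ) := by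
      rw [hΓ', hD, mul_sub, sub_mul, mul_one, diagonal_mul_diagonal]
      have : (1 : Matrix ι ι ℂ) = diagonal (fun j => (c j : ℂ) * c j) +
          diagonal fun j => ((1 - c j : ℝ) : ℂ) := by
        rw [diagonal_add, ← diagonal_one]
        congr 1; ext j
        have := c2 j
        rw [← Complex.ofReal_mul, ← sq, this]; push_cast; ring
      nth_rw 1 [this]; abel
    rw [e]
    refine (hvv.mul_mul_conjTranspose_same _).add (PosSemidef.diagonal fun j => ?_)
    simp only [Pi.zero_apply]
    refine Complex.zero_le_real.2 ?_
    simp only [hc]; split_ifs <;> simp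
  have key := ofReal_integral_slice_le (p := 3 / 2) (by norm_num) hLT hU hs hR three_ne_zero hu
    (β := 2 / (3 * √3)) (α := 1) (by positivity) one_pos.le
    fun a f ha hf => mul_le_pow_three_add ha hf
  have h1 := (isGramCurve_sliceGram hR hu).integral_trace_pow_three_le
    (integral_sliceGram (fun j => (hu j).contDiff.continuous)
      (fun j => (hu j).contDiff.continuous) fun j => (hu j).eq_zero) hΓ1
  have h2 := sum_energy_eq hu hU.cont
  simp only [fun j => energy_smul (hv j).contDiff U (c j), c2] at h2
  have h3 : ((gram volume (fun j x => (c j : ℂ) • v j x)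
      (fun j x => (c j : ℂ) • v j x)).trace).re ≤ ∑ j, c j := by
    rw [trace, Complex.re_sum]
    refine Finset.sum_le_sum fun j _ => ?_
    have h := (Complex.nonneg_iff.1 (hvv.diag_nonneg (i := j))).1
    rw [diag_apply, gram_smul, mul_comm, ← mul_assoc, ← Complex.ofReal_mul, ← sq, c2,
      Complex.re_ofReal_mul]
    rw [Matrix.sub_apply, one_apply_eq, Complex.sub_re, Complex.one_re] at h
    have : 0 ≤ c j := by rw [← c2]; positivity
    nlinarith
  have e (j) : max (-energy U (v j) - s) 0 = -(c j * energy U (v j)) - s * c j := by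
    simp only [hc]
    split_ifs with h
    · rw [max_eq_left h]; ring
    · rw [max_eq_right (not_le.1 h).le]; ring
  rw [ENNReal.ofReal_mul (by positivity), mul_assoc]
  refine ((ENNReal.ofReal_le_ofReal ?_).trans key).trans_eq ?_
  · rw [Finset.sum_congr rfl fun j _ => e j, Finset.sum_sub_distrib, Finset.sum_neg_distrib,
      ← Finset.mul_sum]
    nlinarith
  · congr 3
    ext x
    congr! 3
    push_cast; ring

end Lifting

lemma convexOn_max_sub_rpow {p : ℝ} (hp : 1 ≤ p) (s : ℝ) :
    ConvexOn ℝ Set.univ fun x : ℝ => max (x - s) 0 ^ p := by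
  refine ⟨convex_univ, fun x _ y _ a b ha hb hab => ?_⟩
  refine le_trans ?_ ((convexOn_rpow hp).2 (Set.mem_Ici.2 (le_max_right (x - s) 0))
    (Set.mem_Ici.2 (le_max_right (y - s) 0)) ha hb hab)
  refine Real.rpow_le_rpow (le_max_right _ _) (max_le ?_ ?_) (by linarith)
  · have h1 := mul_le_mul_of_nonneg_left (le_max_left (x - s) 0) ha
    have h2 := mul_le_mul_of_nonneg_left (le_max_left (y - s) 0) hb
    have h3 : a * s + b * s = s := by rw [← add_mul, hab, one_mul]
    simp only [smul_eq_mul]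
    linarith
  · have := le_max_right (x - s) 0
    have := le_max_right (y - s) 0
    simp only [smul_eq_mul]
    positivity

/-- A Jensen (Berezin) inequality for orthonormal families. -/
lemma sum_max_inner_rpow_le {F κ ι : Type*} [NormedAddCommGroup F] [InnerProductSpace ℂ F]
    [Fintype κ] [Fintype ι] {T : F →L[ℂ] F} {μ : κ → ℝ} (b : OrthonormalBasis κ ℂ F)
    (hb : ∀ k, T (b k) = (μ k : ℂ) • b k) {v : ι → F} (hv : Orthonormal ℂ v) {p : ℝ} (hp : 1 ≤ p)
    (s : ℝ) :
    ∑ j, max ((inner ℂ (v j) (T (v j))).re - s) 0 ^ p ≤ ∑ k, max (μ k - s) 0 ^ p := by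
  have e (w : F) : (inner ℂ w (T w)).re = ∑ k, ‖inner ℂ (b k) w‖ ^ 2 * μ k := by
    have hT : T w = ∑ k, inner ℂ (b k) w • ((μ k : ℂ) • b k) := by
      conv_lhs => rw [← b.sum_repr' w]
      simp [map_sum, hb]
    rw [hT, inner_sum, Complex.re_sum]
    refine Finset.sum_congr rfl fun k _ => ?_
    rw [inner_smul_right, inner_smul_right, mul_left_comm, ← inner_conj_symm w (b k),
      Complex.mul_conj, Complex.re_ofReal_mul, Complex.ofReal_re, Complex.normSq_eq_norm_sq, mul_comm]
  have h1 (j) : max ((inner ℂ (v j) (T (v j))).re - s) 0 ^ p ≤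
      ∑ k, ‖inner ℂ (b k) (v j)‖ ^ 2 * max (μ k - s) 0 ^ p := by
    rw [e]
    refine (convexOn_max_sub_rpow hp s).map_sum_le (fun k _ => by positivity) ?_
      fun k _ => Set.mem_univ _
    rw [b.sum_sq_norm_inner_right, hv.1 j, one_pow]
  refine (Finset.sum_le_sum fun j _ => h1 j).trans ?_
  rw [Finset.sum_comm]
  refine Finset.sum_le_sum fun k _ => ?_
  rw [← Finset.sum_mul]
  have h2 : ∑ j, ‖inner ℂ (b k) (v j)‖ ^ 2 ≤ 1 := by
    have := hv.sum_inner_products_le (b k) (s := Finset.univ)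
    rw [b.orthonormal.1 k, one_pow] at this
    simpa only [norm_inner_symm (b k)] using this
  exact mul_le_of_le_one_left (Real.rpow_nonneg (le_max_right _ _) _) h2

lemma LTBound.zero_dim {F κ : Type*} [NormedAddCommGroup F] [InnerProductSpace ℂ F]
    [Fintype κ] {p : ℝ} (hp : 1 ≤ p) : LTBound F κ 0 p 1 := by
  intro U μ hU s hs ι _ _ R u hu huu
  obtain ⟨b, hb⟩ := hU.eig 0
  have hv : Orthonormal ℂ fun j => u j 0 := by
    rw [orthonormal_iff_ite]
    intro j k
    have := congrFun (congrFun huu j) k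
    simpa [gram, Measure.volume_pi_eq_dirac (0 : Fin 0 → ℝ), one_apply] using this
  have := sum_max_inner_rpow_le b hb hv hp s
  simp only [Measure.volume_pi_eq_dirac (0 : Fin 0 → ℝ), energy, lintegral_dirac]
  simpa using ENNReal.ofReal_le_ofReal this

open ProbabilityTheory in
lemma lintegral_rpow_mul_max_sub_rpow {r σ : ℝ} (hr : 0 < r) (hσ : 0 < σ) (a : ℝ) :
    ∫⁻ τ in Set.Ioi (0 : ℝ), ENNReal.ofReal (τ ^ (r - 1) * max (a - τ) 0 ^ σ) =
      ENNReal.ofReal (beta r (σ + 1) * max a 0 ^ (r + σ)) := by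
  rcases le_or_gt a 0 with ha | ha
  · rw [max_eq_right ha, Real.zero_rpow (by positivity), mul_zero, ENNReal.ofReal_zero]
    refine setLIntegral_eq_zero measurableSet_Ioi fun τ hτ => ?_
    have : a - τ ≤ 0 := by have := Set.mem_Ioi.1 hτ; linarith
    simp [max_eq_right this, Real.zero_rpow hσ.ne']
  have hβ : 0 < beta r (σ + 1) := beta_pos hr (by linarith)
  have key (τ : ℝ) : (Set.Ioi (0 : ℝ)).indicator
      (fun τ => ENNReal.ofReal (τ ^ (r - 1) * max (a - τ) 0 ^ σ)) τ =
      ENNReal.ofReal (beta r (σ + 1) * a ^ (r + σ - 1)) * betaPDF r (σ + 1) (a⁻¹ * τ) := by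
    rcases le_or_gt τ 0 with h0 | h0
    · rw [Set.indicator_of_notMem (by simpa using h0), betaPDF_eq_zero_of_nonpos
        (mul_nonpos_of_nonneg_of_nonpos (by positivity) h0), mul_zero]
    rw [Set.indicator_of_mem (Set.mem_Ioi.2 h0)]
    rcases le_or_gt a τ with h1 | h1
    · rw [max_eq_right (by linarith), Real.zero_rpow hσ.ne', betaPDF_eq_zero_of_one_le
        (by rw [inv_mul_eq_div, one_le_div ha]; exact h1)]
      simp
    · rw [max_eq_left (by linarith), betaPDF_of_pos_lt_one (by positivity)
        (by rw [inv_mul_eq_div, div_lt_one ha]; exact h1), ← ENNReal.ofReal_mul (by positivity)]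
      congr 1
      have e1 : 1 - a⁻¹ * τ = a⁻¹ * (a - τ) := by field_simp
      rw [e1, Real.mul_rpow (by positivity) h0.le, Real.mul_rpow (by positivity) (by linarith),
        add_sub_cancel_right, Real.inv_rpow ha.le, Real.inv_rpow ha.le,
        show r + σ - 1 = (r - 1) + σ by ring, Real.rpow_add ha]
      field_simp
  rw [← lintegral_indicator measurableSet_Ioi, lintegral_congr key,
    lintegral_const_mul' _ _ ENNReal.ofReal_ne_top]
  have hsc : ∫⁻ τ, betaPDF r (σ + 1) (a⁻¹ * τ) = ENNReal.ofReal a := by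
    have hm : Measurable (betaPDF r (σ + 1)) := (measurable_betaPDFReal _ _).ennreal_ofReal
    rw [← lintegral_map hm (measurable_const_mul a⁻¹), Real.map_volume_mul_left (by positivity),
      lintegral_smul_measure, lintegral_betaPDF_eq_one hr (by linarith), inv_inv, abs_of_pos ha]
    simp
  rw [hsc, ← ENNReal.ofReal_mul (by positivity), max_eq_left ha.le, mul_assoc]
  congr 2
  rw [← Real.rpow_add_one ha.ne']
  congr 1; ring

lemma ofReal_beta_mul_sum {κ : Type*} [Fintype κ] {r σ : ℝ} (hr : 0 < r) (hσ : 0 < σ) (a : κ → ℝ)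
    (s : ℝ) :
    ENNReal.ofReal (ProbabilityTheory.beta r (σ + 1)) *
      ENNReal.ofReal (∑ k, max (a k - s) 0 ^ (r + σ)) =
    ∫⁻ τ in Set.Ioi (0 : ℝ),
      ENNReal.ofReal (τ ^ (r - 1)) * ENNReal.ofReal (∑ k, max (a k - (s + τ)) 0 ^ σ) := by
  have hβ := ProbabilityTheory.beta_pos hr (by linarith : 0 < σ + 1)
  rw [← ENNReal.ofReal_mul hβ.le, Finset.mul_sum, ENNReal.ofReal_sum_of_nonneg fun k _ =>
    mul_nonneg hβ.le (Real.rpow_nonneg (le_max_right _ _) _)]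
  simp_rw [← lintegral_rpow_mul_max_sub_rpow hr hσ]
  rw [← lintegral_finsetSum' _ fun k _ => by fun_prop]
  refine setLIntegral_congr_fun measurableSet_Ioi fun τ hτ => ?_
  have h0 : 0 ≤ τ ^ (r - 1) := Real.rpow_nonneg (Set.mem_Ioi.1 hτ).le _
  rw [← ENNReal.ofReal_mul h0, Finset.mul_sum, ENNReal.ofReal_sum_of_nonneg fun k _ =>
    mul_nonneg h0 (Real.rpow_nonneg (le_max_right _ _) _)]
  simp only [sub_sub]

/-- The Aizenman–Lieb monotonicity argument. -/
lemma aizenmanLieb {X κ ι : Type*} [MeasurableSpace X] {ν : Measure X} [SFinite ν] [Fintype κ]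
    [Fintype ι] (e : ι → ℝ) {μ : X → κ → ℝ} {C : ENNReal} (hC : C ≠ ⊤) {s σ q r : ℝ}
    (hr : 0 < r) (hσ : 0 < σ) (hq : 0 < q)
    (hμ : ∀ s, Measurable fun x => ∑ k, max (μ x k - s) 0 ^ q)
    (h : ∀ t, s ≤ t → ENNReal.ofReal (∑ j, max (e j - t) 0 ^ σ) ≤
      C * ∫⁻ x, ENNReal.ofReal (∑ k, max (μ x k - t) 0 ^ q) ∂ν) :
    ENNReal.ofReal (ProbabilityTheory.beta r (σ + 1)) *
      ENNReal.ofReal (∑ j, max (e j - s) 0 ^ (r + σ)) ≤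
    C * (ENNReal.ofReal (ProbabilityTheory.beta r (q + 1)) *
      ∫⁻ x, ENNReal.ofReal (∑ k, max (μ x k - s) 0 ^ (r + q)) ∂ν) := by
  have hm : Measurable (Function.uncurry fun (τ : ℝ) (x : X) =>
      ENNReal.ofReal (τ ^ (r - 1)) * ENNReal.ofReal (∑ k, max (μ x k - (s + τ)) 0 ^ q)) := by
    refine Measurable.mul (by fun_prop) (Measurable.ennreal_ofReal ?_)
    refine measurable_uncurry_of_continuous_of_measurable
      (u := fun (τ : ℝ) (x : X) => ∑ k, max (μ x k - (s + τ)) 0 ^ q) (fun x => ?_) fun τ => hμ _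
    refine continuous_finsetSum _ fun k _ => Continuous.rpow_const (by fun_prop) fun _ => Or.inr hq.le
  rw [ofReal_beta_mul_sum hr hσ, ← lintegral_const_mul' _ _ ENNReal.ofReal_ne_top]
  simp_rw [ofReal_beta_mul_sum hr hq]
  rw [lintegral_lintegral_swap (f := fun x τ => ENNReal.ofReal (τ ^ (r - 1)) *
    ENNReal.ofReal (∑ k, max (μ x k - (s + τ)) 0 ^ q)) (hm.comp measurable_swap).aemeasurable,
    ← lintegral_const_mul' _ _ hC]
  refine setLIntegral_mono' measurableSet_Ioi fun τ hτ => ?_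
  rw [lintegral_const_mul' _ _ ENNReal.ofReal_ne_top, mul_left_comm]
  gcongr
  exact h _ (by have := Set.mem_Ioi.1 hτ; linarith)

section Constants

lemma Lcl_nonneg {γ : ℝ} (hγ : 0 ≤ γ) (d : ℕ) : 0 ≤ Lcl γ d := by
  have h1 := Real.Gamma_pos_of_pos (by positivity : 0 < γ + 1)
  have h2 := Real.Gamma_pos_of_pos (by positivity : 0 < γ + d / 2 + 1)
  unfold Lcl
  positivity

lemma Lcl_zero_dim {γ : ℝ} (hγ : 0 ≤ γ) : Lcl γ 0 = 1 := by
  have h1 := Real.Gamma_pos_of_pos (by positivity : 0 < γ + 1)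
  simp [Lcl, h1.ne']

lemma Lcl_add {r σ : ℝ} (hr : 0 < r) (hσ : 0 < σ) (d : ℕ) :
    Lcl σ d * ProbabilityTheory.beta r (σ + d / 2 + 1) =
      ProbabilityTheory.beta r (σ + 1) * Lcl (r + σ) d := by
  have h1 := Real.Gamma_pos_of_pos (by positivity : 0 < σ + d / 2 + 1)
  have h2 := Real.Gamma_pos_of_pos (by positivity : 0 < r + σ + d / 2 + 1)
  have h3 := Real.Gamma_pos_of_pos (by positivity : 0 < r + σ + 1)
  simp only [Lcl, ProbabilityTheory.beta]
  rw [show r + (σ + d / 2 + 1) = r + σ + d / 2 + 1 by ring,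
    show r + (σ + 1) = r + σ + 1 by ring]
  field_simp

lemma gamma_five_halves : Real.Gamma (3 / 2 + 1) = 3 / 4 * √Real.pi := by
  rw [Real.Gamma_add_one (by norm_num), show (3 / 2 : ℝ) = 1 / 2 + 1 by norm_num,
    Real.Gamma_add_one (by norm_num), Real.Gamma_one_half_eq]
  ring

lemma pi_rpow_succ (d : ℕ) :
    Real.pi ^ (((d + 1 : ℕ) : ℝ) / 2) = Real.pi ^ ((d : ℝ) / 2) * √Real.pi := by
  rw [Real.sqrt_eq_rpow, ← Real.rpow_add Real.pi_pos]
  push_cast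
  congr 1; ring

lemma Lcl_three_halves_succ (d : ℕ) : 3 / 16 * Lcl 2 d = Lcl (3 / 2) (d + 1) := by
  have h1 := Real.Gamma_pos_of_pos (by positivity : (0 : ℝ) < 2 + d / 2 + 1)
  have h2 : 0 < Real.pi ^ ((d : ℝ) / 2) := Real.rpow_pos_of_pos Real.pi_pos _
  have h3 : 0 < √Real.pi := Real.sqrt_pos.2 Real.pi_pos
  have h4 : Real.Gamma (2 + 1) = 2 := by simpa using Real.Gamma_nat_eq_factorial 2
  rw [Lcl, Lcl, gamma_five_halves, pi_rpow_succ, h4,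
    show (3 / 2 : ℝ) + ((d + 1 : ℕ) : ℝ) / 2 + 1 = 2 + d / 2 + 1 by push_cast; ring]
  field_simp
  ring

lemma Lcl_one_succ (d : ℕ) :
    2 / (3 * √3) * Lcl (3 / 2) d = Real.pi / √3 * Lcl 1 (d + 1) := by
  have h1 := Real.Gamma_pos_of_pos (by positivity : (0 : ℝ) < 3 / 2 + d / 2 + 1)
  have h2 : 0 < Real.pi ^ ((d : ℝ) / 2) := Real.rpow_pos_of_pos Real.pi_pos _
  have h3 : 0 < √Real.pi := Real.sqrt_pos.2 Real.pi_pos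
  have h4 : Real.Gamma (1 + 1) = 1 := by simpa using Real.Gamma_nat_eq_factorial 1
  have h5 : 0 < √(3 : ℝ) := by positivity
  have h6 : √Real.pi ^ 2 = Real.pi := Real.sq_sqrt Real.pi_pos.le
  rw [Lcl, Lcl, gamma_five_halves, pi_rpow_succ, h4,
    show (1 : ℝ) + ((d + 1 : ℕ) : ℝ) / 2 + 1 = 3 / 2 + d / 2 + 1 by push_cast; ring]
  field_simp
  rw [h6]
  ring

lemma pi_div_sqrt_three_le : Real.pi / √3 ≤ 2 := by
  rw [div_le_iff₀ (by positivity)]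
  have h1 : (1.73 : ℝ) ≤ √3 := Real.le_sqrt_of_sq_le (by norm_num)
  linarith [Real.pi_lt_d2]

end Constants

/-- Monotonicity in `γ` of the quotient of a Lieb–Thirring constant and `L^cl_{γ,d}`. -/
lemma aizenmanLieb_Lcl {X κ ι : Type*} [MeasurableSpace X] {ν : Measure X} [SFinite ν] [Fintype κ]
    [Fintype ι] (e : ι → ℝ) {μ : X → κ → ℝ} {c s σ r : ℝ} {d : ℕ} (hc : 0 ≤ c)
    (hr : 0 < r) (hσ : 0 < σ)
    (hμ : ∀ s, Measurable fun x => ∑ k, max (μ x k - s) 0 ^ (σ + d / 2))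
    (h : ∀ t, s ≤ t → ENNReal.ofReal (∑ j, max (e j - t) 0 ^ σ) ≤ ENNReal.ofReal (c * Lcl σ d) *
      ∫⁻ x, ENNReal.ofReal (∑ k, max (μ x k - t) 0 ^ (σ + d / 2)) ∂ν) :
    ENNReal.ofReal (∑ j, max (e j - s) 0 ^ (r + σ)) ≤ ENNReal.ofReal (c * Lcl (r + σ) d) *
      ∫⁻ x, ENNReal.ofReal (∑ k, max (μ x k - s) 0 ^ (r + σ + d / 2)) ∂ν := by
  have hβ := ProbabilityTheory.beta_pos hr (by linarith : 0 < σ + 1)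
  have := aizenmanLieb e ENNReal.ofReal_ne_top hr hσ (by positivity) hμ h
  rw [← mul_assoc, ← ENNReal.ofReal_mul (mul_nonneg hc (Lcl_nonneg hσ.le d)), mul_assoc c,
    Lcl_add hr hσ, mul_left_comm, ENNReal.ofReal_mul hβ.le, mul_assoc, ← add_assoc] at this
  exact (ENNReal.mul_le_mul_iff_right (by simpa using hβ) ENNReal.ofReal_ne_top).1 this

lemma LTBound.two {F κ : Type*} [NormedAddCommGroup F] [InnerProductSpace ℂ F] [Fintype κ] {d : ℕ}
    (h : LTBound F κ d (3 / 2) (Lcl (3 / 2) d)) : LTBound F κ d 2 (Lcl 2 d) := by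
  intro U μ hU s hs ι _ _ R u hu huu
  have := aizenmanLieb_Lcl (r := 1 / 2) (σ := 3 / 2) (s := s) (d := d) (fun j => -energy U (u j))
    (μ := μ) (ν := volume) zero_le_one (by norm_num) (by norm_num)
    (fun t => hU.meas t _ (by positivity)) fun t ht => by
      rw [one_mul]
      exact h U μ hU t (hs.trans ht) ι R u hu huu
  norm_num at this ⊢
  exact this

/-- The sharp Lieb–Thirring inequality of order `3/2`. -/
theorem ltBound_three_halves (F κ : Type*) [NormedAddCommGroup F] [InnerProductSpace ℂ F]
    [Fintype κ] (d : ℕ) : LTBound F κ d (3 / 2) (Lcl (3 / 2) d) := by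
  induction d with
  | zero =>
    rw [Lcl_zero_dim (by norm_num)]
    exact LTBound.zero_dim (by norm_num)
  | succ d ih =>
    rw [← Lcl_three_halves_succ]
    exact ih.two.lift_three_halves

section Cutoff

variable {d : ℕ} {F : Type*} [NormedAddCommGroup F] [InnerProductSpace ℂ F] {R : ℝ}
  {χ : (Fin d → ℝ) → ℝ} {w : (Fin d → ℝ) → F}

/-- The partial derivative of a real function in the `l`-th coordinate direction. -/
noncomputable def rpd (l : Fin d) (χ : (Fin d → ℝ) → ℝ) (x : Fin d → ℝ) : ℝ :=
  lineDeriv ℝ χ x (Pi.single l 1)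

/-- Continuously differentiable real cutoff functions supported, with their first derivatives, in
the open ball of radius `R`. -/
structure IsCutoff (R : ℝ) (χ : (Fin d → ℝ) → ℝ) : Prop where
  nonneg : 0 ≤ R
  contDiff : ContDiff ℝ 1 χ
  eq_zero : ∀ x, R ≤ ‖x‖ → χ x = 0
  rpd_eq_zero : ∀ l x, R ≤ ‖x‖ → rpd l χ x = 0

lemma hasLineDerivAt_rpd (hχ : ContDiff ℝ 1 χ) (l : Fin d) (x : Fin d → ℝ) :
    HasLineDerivAt ℝ χ (rpd l χ x) x (Pi.single l 1) :=
  (hχ.differentiable one_ne_zero x).lineDifferentiableAt.hasLineDerivAt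

lemma continuous_rpd (hχ : ContDiff ℝ 1 χ) (l : Fin d) : Continuous (rpd l χ) := by
  have : rpd l χ = fun x => fderiv ℝ χ x (Pi.single l 1) :=
    funext fun x => (hχ.differentiable one_ne_zero x).lineDeriv_eq_fderiv
  rw [this]
  exact (hχ.continuous_fderiv one_ne_zero).clm_apply continuous_const

lemma hasLineDerivAt_pd (hw : ContDiff ℝ 1 w) (l : Fin d) (x : Fin d → ℝ) :
    HasLineDerivAt ℝ w (pd l w x) x (Pi.single l 1) :=
  (hw.differentiable one_ne_zero x).lineDifferentiableAt.hasLineDerivAt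

lemma pd_cutoff_smul (hχ : ContDiff ℝ 1 χ) (hw : ContDiff ℝ 1 w) (l : Fin d) (x : Fin d → ℝ) :
    pd l (fun x => (χ x : ℂ) • w x) x = (rpd l χ x : ℂ) • w x + (χ x : ℂ) • pd l w x := by
  have h1 : HasDerivAt (fun t : ℝ => χ (x + t • Pi.single l 1)) _ 0 := hasLineDerivAt_rpd hχ l x
  have h2 : HasDerivAt (fun t : ℝ => w (x + t • Pi.single l 1)) _ 0 := hasLineDerivAt_pd hw l x
  have := (h1.fun_smul h2).deriv
  simp only [zero_smul, add_zero] at this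
  simp only [Complex.coe_smul]
  rw [pd, lineDeriv, this, add_comm]

lemma contDiff_cutoff_smul (hχ : ContDiff ℝ 1 χ) (hw : ContDiff ℝ 1 w) :
    ContDiff ℝ 1 fun x => (χ x : ℂ) • w x := by
  simp only [Complex.coe_smul]
  exact hχ.smul hw

lemma IsCutoff.smul (hχ : IsCutoff R χ) (hw : ContDiff ℝ 1 w) :
    IsTest R fun x => (χ x : ℂ) • w x where
  nonneg := hχ.nonneg
  contDiff := contDiff_cutoff_smul hχ.contDiff hw
  eq_zero x hx := by simp [hχ.eq_zero x hx]
  pd_eq_zero l x hx := by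
    rw [pd_cutoff_smul hχ.contDiff hw, hχ.eq_zero x hx, hχ.rpd_eq_zero l x hx]; simp

lemma integral_lineDeriv_eq_zero {g g' : (Fin d → ℝ) → ℝ} {v : Fin d → ℝ} (hg : Integrable g)
    (hg' : Integrable g') (h : ∀ x, HasLineDerivAt ℝ g (g' x) x v) : ∫ x, g' x = 0 := by
  have := integral_bilinear_hasLineDerivAt_right_eq_neg_left_of_integrable (μ := volume)
    (f := fun _ : Fin d → ℝ => (1 : ℝ)) (f' := fun _ => 0) (g := g) (g' := g') (v := v)
    (B := ContinuousLinearMap.mul ℝ ℝ) (by simp) (by simpa using hg') (by simpa using hg)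
    (fun x _ => by simpa [HasLineDerivAt] using hasDerivAt_const (0 : ℝ) (1 : ℝ)) fun x _ => h x
  simpa using this

lemma hasLineDerivAt_flux (hχ : ContDiff ℝ 1 χ) (hw : ContDiff ℝ 1 w) {l : Fin d}
    (hw' : ContDiff ℝ 1 (pd l w)) (x : Fin d → ℝ) :
    HasLineDerivAt ℝ (fun x => χ x ^ 2 * (inner ℂ (w x) (pd l w x)).re)
      (2 * χ x * rpd l χ x * (inner ℂ (w x) (pd l w x)).re +
        χ x ^ 2 * ((inner ℂ (w x) (pd l (pd l w) x)).re + ‖pd l w x‖ ^ 2)) x (Pi.single l 1) := by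
  have h1 : HasDerivAt (fun t : ℝ => χ (x + t • Pi.single l 1)) _ 0 := hasLineDerivAt_rpd hχ l x
  have h2 : HasDerivAt (fun t : ℝ => w (x + t • Pi.single l 1)) _ 0 := hasLineDerivAt_pd hw l x
  have h3 : HasDerivAt (fun t : ℝ => pd l w (x + t • Pi.single l 1)) _ 0 :=
    hasLineDerivAt_pd hw' l x
  have h4 := (h1.fun_pow 2).mul (Complex.reCLM.hasFDerivAt.comp_hasDerivAt (0 : ℝ) (h2.inner ℂ h3))
  refine HasDerivAt.congr_deriv h4 ?_
  simp [← Complex.ofReal_pow]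

/-- The IMS localization formula for a solution of `-Δw - Uw = -Ew`. -/
lemma energy_cutoff_smul {U : (Fin d → ℝ) → F →L[ℂ] F} {E : ℝ}
    (hχ : IsCutoff R χ) (hw : ContDiff ℝ 1 w) (hw' : ∀ l, ContDiff ℝ 1 (pd l w))
    (heq : ∀ x, ∑ l, pd l (pd l w) x + U x (w x) = (E : ℂ) • w x) :
    energy U (fun x => (χ x : ℂ) • w x) =
      ∫ x, ((∑ l, rpd l χ x ^ 2) * ‖w x‖ ^ 2 - E * (χ x ^ 2 * ‖w x‖ ^ 2)) := by
  set g' : Fin d → (Fin d → ℝ) → ℝ := fun l x => 2 * χ x * rpd l χ x * (inner ℂ (w x) (pd l w x)).re +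
        χ x ^ 2 * ((inner ℂ (w x) (pd l (pd l w) x)).re + ‖pd l w x‖ ^ 2) with hg'
  have cχ := hχ.contDiff.continuous
  have cw := hw.continuous
  have cr (l) := continuous_rpd hχ.contDiff l
  have cp (l) := continuous_pd hw l
  have cpp (l) := continuous_pd (hw' l) l
  have ig (l) : Integrable fun x => χ x ^ 2 * (inner ℂ (w x) (pd l w x)).re :=
    integrable_of_continuous_of_norm (R := R)
      ((cχ.pow 2).mul (Complex.continuous_re.comp (cw.inner (cp l))))
      fun x hx => by simp [hχ.eq_zero x hx]
  have ig' (l) : Integrable (g' l) :=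
    integrable_of_continuous_of_norm (R := R)
      ((((continuous_const.mul cχ).mul (cr l)).mul (Complex.continuous_re.comp (cw.inner (cp l)))).add
        ((cχ.pow 2).mul ((Complex.continuous_re.comp (cw.inner (cpp l))).add ((cp l).norm.pow 2))))
      fun x hx => by simp [hg', hχ.eq_zero x hx]
  have i1 : Integrable fun x => (∑ l, rpd l χ x ^ 2) * ‖w x‖ ^ 2 - E * (χ x ^ 2 * ‖w x‖ ^ 2) :=
    integrable_of_continuous_of_norm (R := R)
      (((continuous_finsetSum _ fun l _ => (cr l).pow 2).mul (cw.norm.pow 2)).sub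
        (continuous_const.mul ((cχ.pow 2).mul (cw.norm.pow 2))))
      fun x hx => by simp [hχ.eq_zero x hx, hχ.rpd_eq_zero _ x hx]
  have hz : ∫ x, ∑ l, g' l x = 0 := by
    rw [integral_finsetSum _ fun l _ => ig' l]
    exact Finset.sum_eq_zero fun l _ => integral_lineDeriv_eq_zero (ig l) (ig' l)
      (hasLineDerivAt_flux hχ.contDiff hw (hw' l))
  rw [← add_zero (∫ x, ((∑ l, rpd l χ x ^ 2) * ‖w x‖ ^ 2 - E * (χ x ^ 2 * ‖w x‖ ^ 2))), ← hz,
    ← integral_add i1 (integrable_finsetSum _ fun l _ => ig' l), energy]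
  congr 1
  funext x
  have e1 : U x (w x) = (E : ℂ) • w x - ∑ l, pd l (pd l w) x := by rw [← heq x]; abel
  have e2 (l) : ‖pd l (fun x => (χ x : ℂ) • w x) x‖ ^ 2 = rpd l χ x ^ 2 * ‖w x‖ ^ 2 +
      2 * χ x * rpd l χ x * (inner ℂ (w x) (pd l w x)).re + χ x ^ 2 * ‖pd l w x‖ ^ 2 := by
    rw [pd_cutoff_smul hχ.contDiff hw, @norm_add_sq ℂ, inner_smul_left, inner_smul_right,
      norm_smul, norm_smul, Complex.conj_ofReal, ← mul_assoc, ← Complex.ofReal_mul]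
    simp only [RCLike.re_to_complex, Complex.re_ofReal_mul, mul_pow, Complex.norm_real,
      Real.norm_eq_abs, sq_abs]
    ring
  have e3 : (inner ℂ (w x) (w x)).re = ‖w x‖ ^ 2 := by
    rw [inner_self_eq_norm_sq_to_K]; norm_cast
  have e4 : (inner ℂ ((χ x : ℂ) • w x) (U x ((χ x : ℂ) • w x))).re =
      χ x ^ 2 * (E * ‖w x‖ ^ 2 - ∑ l, (inner ℂ (w x) (pd l (pd l w) x)).re) := by
    rw [map_smul, inner_smul_left, inner_smul_right, Complex.conj_ofReal, ← mul_assoc,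
      ← Complex.ofReal_mul, Complex.re_ofReal_mul, e1, inner_sub_right, inner_smul_right,
      inner_sum, Complex.sub_re, Complex.re_ofReal_mul, e3, Complex.re_sum, pow_two (χ x)]
  rw [e4]
  simp only [e2, hg', Finset.sum_add_distrib, ← Finset.mul_sum, ← Finset.sum_mul, mul_add]
  ring

end Cutoff

section Truncation

variable {d : ℕ} {F : Type*} [NormedAddCommGroup F] [InnerProductSpace ℂ F]

/-- Smooth cutoffs with vanishing gradients, converging to one. -/
lemma exists_cutoff_seq (d : ℕ) : ∃ (χ : ℕ → (Fin d → ℝ) → ℝ) (C : ℝ),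
    (∀ m : ℕ, IsCutoff (3 * ((m : ℝ) + 1)) (χ m)) ∧ (∀ m x, 0 ≤ χ m x) ∧ (∀ m x, χ m x ≤ 1) ∧
    (∀ x, Filter.Tendsto (fun m => χ m x) Filter.atTop (nhds 1)) ∧
    ∀ m x, ∑ l, rpd l (χ m) x ^ 2 ≤ C / (m + 1) ^ 2 := by
  let f : ContDiffBump (0 : Fin d → ℝ) := ⟨1, 2, one_pos, one_lt_two⟩
  have hf : ContDiff ℝ 1 f := f.contDiff
  have hfd (l : Fin d) (x : Fin d → ℝ) : rpd l f x = fderiv ℝ f x (Pi.single l 1) :=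
    (hf.differentiable one_ne_zero x).lineDeriv_eq_fderiv
  have hb (l : Fin d) : ∃ C, ∀ x, ‖rpd l f x‖ ≤ C := by
    refine HasCompactSupport.exists_bound_of_continuous ?_ (continuous_rpd hf l)
    rw [funext (hfd l)]
    exact f.hasCompactSupport.fderiv_apply ℝ _
  choose C hC using hb
  have hsc (m : ℕ) : ContDiff ℝ 1 fun x : Fin d → ℝ => f (((m : ℝ) + 1)⁻¹ • x) :=
    hf.comp (contDiff_const_smul _)
  have hpd (m : ℕ) (l : Fin d) (x : Fin d → ℝ) :
      rpd l (fun x => f (((m : ℝ) + 1)⁻¹ • x)) x =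
        ((m : ℝ) + 1)⁻¹ * rpd l f (((m : ℝ) + 1)⁻¹ • x) := by
    rw [rpd, ((hsc m).differentiable one_ne_zero x).lineDeriv_eq_fderiv, fderiv_comp_smul, hfd]
    rfl
  have hnorm (m : ℕ) (x : Fin d → ℝ) (hx : 3 * ((m : ℝ) + 1) ≤ ‖x‖) :
      3 ≤ ‖((m : ℝ) + 1)⁻¹ • x‖ := by
    have : (0 : ℝ) < m + 1 := by positivity
    rw [norm_smul, norm_inv, Real.norm_of_nonneg this.le, inv_mul_eq_div, le_div_iff₀ this]
    exact hx
  refine ⟨fun m x => f (((m : ℝ) + 1)⁻¹ • x), ∑ l, C l ^ 2, fun m => ⟨by positivity, hsc m,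
    fun x hx => ?_, fun l x hx => ?_⟩, fun m x => f.nonneg, fun m x => f.le_one, fun x => ?_,
    fun m x => ?_⟩
  · refine f.zero_of_le_dist ?_
    rw [dist_zero_right]
    exact le_trans (by norm_num [f]) (hnorm m x hx)
  · have h3 := hnorm m x hx
    have : f =ᶠ[nhds (((m : ℝ) + 1)⁻¹ • x)] fun _ => 0 := by
      have ho : {y : Fin d → ℝ | 2 < ‖y‖} ∈ nhds (((m : ℝ) + 1)⁻¹ • x) :=
        (isOpen_lt continuous_const continuous_norm).mem_nhds (by
          exact lt_of_lt_of_le (by norm_num) h3)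
      filter_upwards [ho] with y hy
      refine f.zero_of_le_dist ?_
      rw [dist_zero_right]
      exact hy.le
    rw [hpd, hfd, this.fderiv_eq]
    simp
  · have h1 : Filter.Tendsto (fun m : ℕ => ((m : ℝ) + 1)⁻¹ • x) Filter.atTop (nhds 0) := by
      have : Filter.Tendsto (fun m : ℕ => ((m : ℝ) + 1)⁻¹) Filter.atTop (nhds 0) := by
        simpa [one_div] using tendsto_one_div_add_atTop_nhds_zero_nat (𝕜 := ℝ)
      simpa using this.smul_const x
    have h2 := (f.continuous.tendsto 0).comp h1
    rwa [f.one_of_mem_closedBall (by simp [f])] at h2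
  · simp only [hpd]
    rw [Finset.sum_div]
    refine Finset.sum_le_sum fun l _ => ?_
    rw [mul_pow, inv_pow, inv_mul_eq_div]
    refine div_le_div_of_nonneg_right ?_ (by positivity)
    rw [← sq_abs]
    exact pow_le_pow_left₀ (abs_nonneg _) (hC l _) 2

lemma tendsto_energy_cutoff_smul {U : (Fin d → ℝ) → F →L[ℂ] F} {E : ℝ} {w : (Fin d → ℝ) → F}
    {χ : ℕ → (Fin d → ℝ) → ℝ} {C : ℝ} (hχ : ∀ m : ℕ, IsCutoff (3 * ((m : ℝ) + 1)) (χ m))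
    (h0 : ∀ m x, 0 ≤ χ m x) (h1 : ∀ m x, χ m x ≤ 1)
    (hlim : ∀ x, Filter.Tendsto (fun m => χ m x) Filter.atTop (nhds 1))
    (hC : ∀ m x, ∑ l, rpd l (χ m) x ^ 2 ≤ C / (m + 1) ^ 2)
    (hw : ContDiff ℝ 1 w) (hw' : ∀ l, ContDiff ℝ 1 (pd l w))
    (heq : ∀ x, ∑ l, pd l (pd l w) x + U x (w x) = (E : ℂ) • w x)
    (hw2 : Integrable fun x => ‖w x‖ ^ 2) :
    Filter.Tendsto (fun m => energy U fun x => (χ m x : ℂ) • w x) Filter.atTop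
      (nhds (-(E * ∫ x, ‖w x‖ ^ 2))) := by
  simp_rw [fun m => energy_cutoff_smul (hχ m) hw hw' heq]
  have hC0 : 0 ≤ C := by
    have := (Finset.sum_nonneg fun l _ => sq_nonneg (rpd l (χ 0) 0)).trans (hC 0 0)
    simpa using this
  have hCm (m : ℕ) : C / ((m : ℝ) + 1) ^ 2 ≤ C := div_le_self hC0 (one_le_pow₀ (by simp))
  have hlim2 : Filter.Tendsto (fun m : ℕ => C / ((m : ℝ) + 1) ^ 2) Filter.atTop (nhds 0) := by
    have := ((tendsto_one_div_add_atTop_nhds_zero_nat (𝕜 := ℝ)).pow 2).const_mul C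
    simpa [div_eq_mul_inv] using this
  have e : -(E * ∫ x, ‖w x‖ ^ 2) = ∫ x, (0 * ‖w x‖ ^ 2 - E * (1 ^ 2 * ‖w x‖ ^ 2)) := by
    rw [← integral_const_mul, ← integral_neg]; simp
  rw [e]
  refine tendsto_integral_of_dominated_convergence (fun x => (C + |E|) * ‖w x‖ ^ 2) (fun m => ?_)
    (hw2.const_mul _) (fun m => Filter.Eventually.of_forall fun x => ?_)
    (Filter.Eventually.of_forall fun x => ?_)
  · have cχ := (hχ m).contDiff.continuous
    have cr (l) := continuous_rpd (hχ m).contDiff l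
    exact (((continuous_finsetSum _ fun l _ => (cr l).pow 2).mul (hw.continuous.norm.pow 2)).sub
        (continuous_const.mul ((cχ.pow 2).mul (hw.continuous.norm.pow 2)))).aestronglyMeasurable
  · refine (norm_sub_le _ _).trans ?_
    rw [add_mul]
    simp only [norm_mul, norm_pow, Real.norm_eq_abs, abs_norm]
    rw [abs_of_nonneg (Finset.sum_nonneg fun l _ => sq_nonneg _), abs_of_nonneg (h0 m x)]
    gcongr
    · exact (hC m x).trans (hCm m)
    · exact mul_le_of_le_one_left (sq_nonneg _) (pow_le_one₀ (h0 m x) (h1 m x))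
  · refine Filter.Tendsto.sub (Filter.Tendsto.mul_const _ ?_)
      ((((hlim x).pow 2).mul_const _).const_mul _)
    exact squeeze_zero (fun m => Finset.sum_nonneg fun l _ => sq_nonneg _) (fun m => hC m x) hlim2

variable {ι : Type} [Fintype ι] {w : ι → (Fin d → ℝ) → F}

omit [Fintype ι] in
lemma integrable_inner_of_sq (hw : ∀ j, Continuous (w j))
    (hw2 : ∀ j, Integrable fun x => ‖w j x‖ ^ 2) (j k : ι) :
    Integrable fun x => (inner ℂ (w j x) (w k x) : ℂ) := by
  refine ((hw2 j).add (hw2 k)).mono' ((hw j).inner (hw k)).aestronglyMeasurable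
    (Filter.Eventually.of_forall fun x => ?_)
  have := norm_inner_le_norm (𝕜 := ℂ) (w j x) (w k x)
  simp only [Pi.add_apply]
  nlinarith [sq_nonneg (‖w j x‖ - ‖w k x‖), norm_nonneg (w j x), norm_nonneg (w k x)]

lemma posSemidef_one_sub_gram_cutoff [DecidableEq ι] (hw : ∀ j, Continuous (w j))
    (hw2 : ∀ j, Integrable fun x => ‖w j x‖ ^ 2) (hww : gram volume w w = 1)
    {χ : (Fin d → ℝ) → ℝ} (hχ : Continuous χ) (h0 : ∀ x, 0 ≤ χ x) (h1 : ∀ x, χ x ≤ 1) :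
    (1 - gram volume (fun j x => (χ x : ℂ) • w j x) fun j x => (χ x : ℂ) • w j x).PosSemidef := by
  have hχw (j) : Continuous fun x => (χ x : ℂ) • w j x :=
    (Complex.continuous_ofReal.comp hχ).smul (hw j)
  have hχw2 (j) : Integrable fun x => ‖(χ x : ℂ) • w j x‖ ^ 2 := by
    refine (hw2 j).mono' ((hχw j).norm.pow 2).aestronglyMeasurable
      (Filter.Eventually.of_forall fun x => ?_)
    rw [norm_smul, mul_pow, norm_mul, norm_pow, norm_pow, norm_norm, norm_norm, Complex.norm_real,
      Real.norm_of_nonneg (h0 x)]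
    exact mul_le_of_le_one_left (sq_nonneg _) (pow_le_one₀ (h0 x) (h1 x))
  have hsum (ξ : ι → ℂ) (f : ι → (Fin d → ℝ) → F)
      (hf : ∀ j k, Integrable fun x => (inner ℂ (f j x) (f k x) : ℂ)) :
      Integrable fun x => (inner ℂ (∑ j, ξ j • f j x) (∑ k, ξ k • f k x) : ℂ) := by
    simp_rw [sum_inner, inner_sum, inner_smul_left, inner_smul_right]
    exact integrable_finsetSum _ fun j _ => integrable_finsetSum _ fun k _ =>
      ((hf j k).const_mul _).const_mul _
  have i1 := integrable_inner_of_sq hw hw2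
  have i2 := integrable_inner_of_sq hχw hχw2
  refine PosSemidef.of_dotProduct_mulVec_nonneg
    (isHermitian_one.sub gram_conjTranspose) fun ξ => ?_
  rw [← hww, sub_mulVec, dotProduct_sub, star_dotProduct_gram_mulVec i1,
    star_dotProduct_gram_mulVec i2, ← integral_sub (hsum ξ _ i1) (hsum ξ _ i2)]
  have e (x) : (inner ℂ (∑ j, ξ j • w j x) (∑ k, ξ k • w k x) : ℂ) -
      inner ℂ (∑ j, ξ j • (χ x : ℂ) • w j x) (∑ k, ξ k • (χ x : ℂ) • w k x) =
      (((1 - χ x ^ 2) * ‖∑ j, ξ j • w j x‖ ^ 2 : ℝ) : ℂ) := by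
    simp_rw [smul_comm _ (χ x : ℂ), ← Finset.smul_sum]
    have hn (v : F) : (inner ℂ v v : ℂ) = ((‖v‖ ^ 2 : ℝ) : ℂ) := by
      rw [inner_self_eq_norm_sq_to_K]; norm_cast
    rw [inner_smul_left, inner_smul_right, hn, Complex.conj_ofReal]
    push_cast
    ring
  simp_rw [e]
  rw [integral_complex_ofReal]
  refine Complex.zero_le_real.2 (integral_nonneg fun x => mul_nonneg ?_ (sq_nonneg _))
  exact sub_nonneg.2 (pow_le_one₀ (h0 x) (h1 x))

end Truncation

/-- The Lieb–Thirring inequality for eigenfunctions, with constant `π / √3` times the classical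
one. -/
theorem ofReal_sum_rpow_le {d : ℕ} {F κ : Type*} [NormedAddCommGroup F] [InnerProductSpace ℂ F]
    [Fintype κ] {U : (Fin (d + 1) → ℝ) → F →L[ℂ] F} {μ : (Fin (d + 1) → ℝ) → κ → ℝ}
    (hU : IsWell U μ) {γ : ℝ} (hγ : 1 ≤ γ) {ι : Type} [Fintype ι] [DecidableEq ι]
    {w : ι → (Fin (d + 1) → ℝ) → F} {E : ι → ℝ} (hE : ∀ j, 0 ≤ E j)
    (hw : ∀ j, ContDiff ℝ 1 (w j)) (hw' : ∀ j l, ContDiff ℝ 1 (pd l (w j)))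
    (heq : ∀ j x, ∑ l, pd l (pd l (w j)) x + U x (w j x) = (E j : ℂ) • w j x)
    (hw2 : ∀ j, Integrable fun x => ‖w j x‖ ^ 2) (hww : gram volume w w = 1) :
    ENNReal.ofReal (∑ j, E j ^ γ) ≤ ENNReal.ofReal (Real.pi / √3 * Lcl γ (d + 1)) *
      ∫⁻ x, ENNReal.ofReal (∑ k, max (μ x k) 0 ^ (γ + ((d + 1 : ℕ) : ℝ) / 2)) := by
  obtain ⟨χ, C, hχ, h0, h1, hlim, hC⟩ := exists_cutoff_seq (d + 1)
  have hnorm (j) : ∫ x, ‖w j x‖ ^ 2 = 1 := by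
    rw [← re_integral_inner_self]
    have := congrFun (congrFun hww j) j
    simp only [gram, of_apply, one_apply_eq] at this
    rw [this, Complex.one_re]
  have hone (t : ℝ) (ht : 0 ≤ t) : ENNReal.ofReal (∑ j, max (E j - t) 0) ≤
      ENNReal.ofReal (Real.pi / √3 * Lcl 1 (d + 1)) *
        ∫⁻ x, ENNReal.ofReal (∑ k, max (μ x k - t) 0 ^ (1 + ((d + 1 : ℕ) : ℝ) / 2)) := by
    have hlt (j) : Filter.Tendsto (fun m => energy U fun x => (χ m x : ℂ) • w j x) Filter.atTop
        (nhds (-E j)) := by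
      simpa [hnorm] using
        tendsto_energy_cutoff_smul hχ h0 h1 hlim hC (hw j) (hw' j) (heq j) (hw2 j)
    have hlt' : Filter.Tendsto
        (fun m => ∑ j, max (-energy U (fun x => (χ m x : ℂ) • w j x) - t) 0) Filter.atTop
        (nhds (∑ j, max (E j - t) 0)) := by
      refine tendsto_finsetSum _ fun j _ => ?_
      have := (((hlt j).neg.sub_const t).max (tendsto_const_nhds (x := (0 : ℝ))))
      rwa [neg_neg] at this
    refine le_of_tendsto (ENNReal.tendsto_ofReal hlt') (Filter.Eventually.of_forall fun m => ?_)
    rw [← Lcl_one_succ]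
    exact (ltBound_three_halves F κ d).lift_one hU ht (fun j => (hχ m).smul (hw j))
      (posSemidef_one_sub_gram_cutoff (fun j => (hw j).continuous) hw2 hww
        (hχ m).contDiff.continuous (h0 m) (h1 m))
  rcases hγ.eq_or_lt with rfl | hγ
  · simpa [fun j => max_eq_left (hE j)] using hone 0 le_rfl
  · have := aizenmanLieb_Lcl (r := γ - 1) (σ := 1) (s := 0) (d := d + 1) E
      (μ := μ) (ν := volume) (c := Real.pi / √3) (by positivity) (by linarith) one_pos
      (fun t => hU.meas t _ (by positivity)) fun t ht => by simpa using hone t ht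
    simpa [fun j => max_eq_left (hE j)] using this

section MatrixPotential

variable {n : ℕ}

lemma re_trace_aeval {A : Matrix (Fin n) (Fin n) ℂ} (hA : A.IsHermitian) (q : Polynomial ℝ) :
    (Polynomial.aeval A (q.map Complex.ofRealHom)).trace.re = ∑ k, q.eval (hA.eigenvalues k) := by
  have h : Polynomial.aeval A (q.map Complex.ofRealHom) =
      Unitary.conjStarAlgAut ℂ (Matrix (Fin n) (Fin n) ℂ) hA.eigenvectorUnitary
        (diagonal fun k => ((q.eval (hA.eigenvalues k) : ℝ) : ℂ)) := by
    conv_lhs => rw [hA.spectral_theorem]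
    rw [Polynomial.aeval_algHom_apply]
    congr 1
    have := Polynomial.aeval_algHom_apply (diagonalAlgHom (n := Fin n) (α := ℂ) ℂ)
      (RCLike.ofReal ∘ hA.eigenvalues) (q.map Complex.ofRealHom)
    simp only [diagonalAlgHom_apply] at this
    rw [this, Polynomial.aeval_pi_apply]
    congr 1
    funext k
    simp only [Polynomial.coe_aeval_eq_eval, Polynomial.eval_map]
    exact Polynomial.eval₂_at_apply Complex.ofRealHom _
  rw [h, Unitary.conjStarAlgAut_apply, trace_mul_cycle, Unitary.coe_star_mul_self, one_mul,
    trace_diagonal]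
  simp

lemma measurable_sum_eigenvalues {X : Type*} [TopologicalSpace X] [MeasurableSpace X]
    [OpensMeasurableSpace X] {A : X → Matrix (Fin n) (Fin n) ℂ} (hc : Continuous A)
    (hA : ∀ x, (A x).IsHermitian) {f : ℝ → ℝ} (hf : Continuous f) :
    Measurable fun x => ∑ k, f ((hA x).eigenvalues k) := by
  have h (m : ℕ) := exists_polynomial_near_of_continuousOn (-m) m f hf.continuousOn
    (1 / ((m : ℝ) + 1)) (by positivity)
  choose q hq using h
  refine measurable_of_tendsto_metrizable
    (f := fun m x => ∑ k, (q m).eval ((hA x).eigenvalues k)) (fun m => ?_) ?_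
  · simp_rw [← re_trace_aeval (hA _)]
    exact (Complex.continuous_re.comp
      (((q m).map Complex.ofRealHom).continuous_aeval.comp hc).matrix_trace).measurable
  · rw [tendsto_pi_nhds]
    refine fun x => tendsto_finsetSum _ fun k _ => ?_
    rw [tendsto_iff_dist_tendsto_zero]
    refine squeeze_zero' (Filter.Eventually.of_forall fun m => dist_nonneg) ?_
      (tendsto_one_div_add_atTop_nhds_zero_nat (𝕜 := ℝ))
    obtain ⟨M, hM⟩ := exists_nat_ge |(hA x).eigenvalues k|
    filter_upwards [Filter.eventually_ge_atTop M] with m hm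
    have hm' : (M : ℝ) ≤ m := by exact_mod_cast hm
    exact (hq m _ (Set.mem_Icc.2 (abs_le.1 (hM.trans hm')))).le

lemma isWell_toEuclideanCLM {d : ℕ} {A : (Fin d → ℝ) → Matrix (Fin n) (Fin n) ℂ}
    (hc : Continuous A) (hA : ∀ x, (A x).IsHermitian) :
    IsWell (fun x => toEuclideanCLM (n := Fin n) (𝕜 := ℂ) (A x))
      fun x k => (hA x).eigenvalues k where
  cont := (LinearMap.continuous_of_finiteDimensional
    (toEuclideanCLM (n := Fin n) (𝕜 := ℂ)).toAlgEquiv.toLinearMap).comp hc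
  eig x := ⟨(hA x).eigenvectorBasis, fun k => by
    ext i
    have := congrFun ((hA x).mulVec_eigenvectorBasis k) i
    simpa using this⟩
  meas s p hp := measurable_sum_eigenvalues hc hA (f := fun r => max (r - s) 0 ^ p)
    (Continuous.rpow_const (by fun_prop) fun _ => Or.inr hp.le)

end MatrixPotential

section Coordinates

variable {d n : ℕ} {φ : EuclideanSpace ℝ (Fin d) → Fin n → ℂ}

/-- A function on Euclidean space with values in `ℂ^n`, viewed on the coordinate space. -/
noncomputable def inCoordinates (φ : EuclideanSpace ℝ (Fin d) → Fin n → ℂ) (x : Fin d → ℝ) :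
    EuclideanSpace ℂ (Fin n) :=
  WithLp.toLp 2 (φ (WithLp.toLp 2 x))

lemma contDiff_inCoordinates {k : WithTop ℕ∞} (hφ : ∀ i, ContDiff ℝ k fun x => φ x i) :
    ContDiff ℝ k (inCoordinates φ) :=
  (PiLp.continuousLinearEquiv 2 ℝ fun _ : Fin n => ℂ).symm.contDiff.comp
    (contDiff_pi.2 fun i => (hφ i).comp
      (PiLp.continuousLinearEquiv 2 ℝ fun _ : Fin d => ℝ).symm.contDiff)

lemma pd_inCoordinates (hφ : ∀ i, ContDiff ℝ 1 fun x => φ x i) (l : Fin d) :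
    pd l (inCoordinates φ) = inCoordinates fun y i =>
      fderiv ℝ (fun z => φ z i) y (EuclideanSpace.single l 1) := by
  funext x
  have h (i : Fin n) := ((hφ i).differentiable one_ne_zero (WithLp.toLp 2 x)).hasFDerivAt.comp x
    (PiLp.continuousLinearEquiv 2 ℝ fun _ : Fin d => ℝ).symm.hasFDerivAt
  have h2 := (PiLp.continuousLinearEquiv 2 ℝ fun _ : Fin n => ℂ).symm.hasFDerivAt.comp x
    (hasFDerivAt_pi.2 h)
  rw [pd_eq_fderiv (contDiff_inCoordinates hφ)]
  refine (congrArg (fun L : (Fin d → ℝ) →L[ℝ] EuclideanSpace ℂ (Fin n) => L (Pi.single l 1))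
    h2.fderiv).trans ?_
  rfl

end Coordinates

section Coordinates

variable {d n : ℕ} {φ χ : EuclideanSpace ℝ (Fin d) → Fin n → ℂ}

lemma pd_pd_inCoordinates (hφ : ∀ i, ContDiff ℝ 2 fun x => φ x i) (l m : Fin d) :
    pd l (pd m (inCoordinates φ)) = inCoordinates fun y i =>
      fderiv ℝ (fun z => fderiv ℝ (fun z => φ z i) z (EuclideanSpace.single m 1)) y
        (EuclideanSpace.single l 1) := by
  rw [pd_inCoordinates (fun i => (hφ i).of_le one_le_two), pd_inCoordinates]
  exact fun i => ((hφ i).fderiv_right (m := 1) (by norm_num)).clm_apply contDiff_const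

lemma contDiff_pd_inCoordinates (hφ : ∀ i, ContDiff ℝ 2 fun x => φ x i) (l : Fin d) :
    ContDiff ℝ 1 (pd l (inCoordinates φ)) := by
  rw [pd_inCoordinates (fun i => (hφ i).of_le one_le_two)]
  exact contDiff_inCoordinates fun i =>
    ((hφ i).fderiv_right (m := 1) (by norm_num)).clm_apply contDiff_const

lemma sum_pd_pd_inCoordinates (hφ : ∀ i, ContDiff ℝ 2 fun x => φ x i) (x : Fin d → ℝ) :
    ∑ l, pd l (pd l (inCoordinates φ)) x =
      inCoordinates (fun y i => lap (fun z => φ z i) y) x := by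
  ext i
  simp only [pd_pd_inCoordinates hφ]
  simp [inCoordinates, lap]

lemma norm_inCoordinates_sq (x : Fin d → ℝ) :
    ‖inCoordinates φ x‖ ^ 2 = ∑ i, Complex.normSq (φ (WithLp.toLp 2 x) i) := by
  simp [inCoordinates, EuclideanSpace.norm_sq_eq, Complex.normSq_eq_norm_sq]

lemma inner_inCoordinates (x : Fin d → ℝ) :
    inner ℂ (inCoordinates φ x) (inCoordinates χ x) =
      ∑ i, (starRingEnd ℂ) (φ (WithLp.toLp 2 x) i) * χ (WithLp.toLp 2 x) i := by
  simp [inCoordinates, PiLp.inner_apply, mul_comm]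

lemma measurableEmbedding_toLp : MeasurableEmbedding
    (WithLp.toLp 2 : (Fin d → ℝ) → EuclideanSpace ℝ (Fin d)) :=
  (MeasurableEquiv.toLp 2 (Fin d → ℝ)).measurableEmbedding

lemma integrable_norm_inCoordinates_sq
    (hφ : Integrable fun x => ∑ i, Complex.normSq (φ x i)) :
    Integrable fun x => ‖inCoordinates φ x‖ ^ 2 := by
  simp_rw [norm_inCoordinates_sq]
  exact ((PiLp.volume_preserving_toLp (Fin d)).integrable_comp_emb
    measurableEmbedding_toLp).2 hφ

lemma integral_inner_inCoordinates :
    ∫ x, inner ℂ (inCoordinates φ x) (inCoordinates χ x) =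
      ∫ x, ∑ i, (starRingEnd ℂ) (φ x i) * χ x i := by
  simp_rw [inner_inCoordinates]
  exact (PiLp.volume_preserving_toLp (Fin d)).integral_comp measurableEmbedding_toLp
    fun x => ∑ i, (starRingEnd ℂ) (φ x i) * χ x i

end Coordinates

lemma lintegral_eigenvalues_eq {d n : ℕ} {W : EuclideanSpace ℝ (Fin d) → Matrix (Fin n) (Fin n) ℂ}
    (hW : ∀ x, (W x).PosSemidef) {p : ℝ}
    (h_integrable : Integrable fun x => traceRpow (W x) (hW x).1 p) :
    ∫⁻ x : Fin d → ℝ, ENNReal.ofReal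
        (∑ k, max ((hW (WithLp.toLp 2 x)).1.eigenvalues k) 0 ^ p) =
      ENNReal.ofReal (∫ x, traceRpow (W x) (hW x).1 p) := by
  rw [ofReal_integral_eq_lintegral_ofReal h_integrable (Filter.Eventually.of_forall fun x =>
    Finset.sum_nonneg fun k _ => Real.rpow_nonneg ((hW x).eigenvalues_nonneg k) _)]
  rw [← (PiLp.volume_preserving_toLp (Fin d)).lintegral_comp_emb measurableEmbedding_toLp]
  simp only [traceRpow, max_eq_left ((hW _).eigenvalues_nonneg _)]

end LiebThirring

open LiebThirring in
/-- **Lieb–Thirring bound `L_{γ,d} ≤ 2 L^cl_{γ,d}` for `1 ≤ γ < 3/2` and all `d ≥ 1`,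
matrix potentials:** `∑ E_j^γ ≤ 2 L^cl_{γ,d} ∫ tr((-V)^{γ+d/2}) dx`. -/
theorem lieb_thirring_two_times_classical (d : ℕ) (hd : 1 ≤ d)
    (n : ℕ) (hn : 1 ≤ n)
    (γ : ℝ) (hγ1 : 1 ≤ γ) (hγ2 : γ < 3 / 2)
    (V : EuclideanSpace ℝ (Fin d) → Matrix (Fin n) (Fin n) ℂ)
    (hVcont : Continuous V)
    (hV : ∀ x, (-(V x)).PosSemidef)
    (hVint : Integrable fun x => traceRpow (-(V x)) (hV x).1 (γ + d / 2))
    (N : ℕ) (ψ : Fin N → EuclideanSpace ℝ (Fin d) → Fin n → ℂ) (E : Fin N → ℝ)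
    (hE : ∀ j, 0 < E j)
    (hψC2 : ∀ j i, ContDiff ℝ 2 fun x => ψ j x i)
    (hψL2 : ∀ j, Integrable fun x => ∑ i, Complex.normSq (ψ j x i))
    (horth : ∀ j l, (∫ x : EuclideanSpace ℝ (Fin d),
        ∑ i, (starRingEnd ℂ) (ψ j x i) * ψ l x i) = if j = l then 1 else 0)
    (heq : ∀ j x i,
      -(lap (fun y => ψ j y i) x) + (V x *ᵥ ψ j x) i = -(E j : ℂ) * ψ j x i) :
    ∑ j, E j ^ γ ≤
      2 * Lcl γ d * ∫ x : EuclideanSpace ℝ (Fin d),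
        traceRpow (-(V x)) (hV x).1 (γ + d / 2) := by
  obtain ⟨d, rfl⟩ := Nat.exists_eq_add_of_le' hd
  have hI : 0 ≤ ∫ x, traceRpow (-(V x)) (hV x).1 (γ + ((d + 1 : ℕ) : ℝ) / 2) :=
    integral_nonneg fun x =>
      Finset.sum_nonneg fun k _ => Real.rpow_nonneg ((hV x).eigenvalues_nonneg k) _
  have hL : 0 ≤ Lcl γ (d + 1) := Lcl_nonneg (by linarith) _
  have hU := isWell_toEuclideanCLM (A := fun x : Fin (d + 1) → ℝ => -V (WithLp.toLp 2 x))
    (hVcont.comp (PiLp.continuousLinearEquiv 2 ℝ fun _ => ℝ).symm.continuous).neg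
    fun x => (hV _).1
  have h := ofReal_sum_rpow_le hU hγ1 (w := fun j => inCoordinates (ψ j)) (fun j => (hE j).le)
    (fun j => (contDiff_inCoordinates (hψC2 j)).of_le one_le_two)
    (fun j l => contDiff_pd_inCoordinates (hψC2 j) l)
    (fun j x => by
      rw [sum_pd_pd_inCoordinates (hψC2 j)]
      ext i
      have := heq j (WithLp.toLp 2 x) i
      simp [inCoordinates]
      linear_combination -this)
    (fun j => integrable_norm_inCoordinates_sq (hψL2 j))
    (by
      ext j l
      rw [one_apply, ← horth j l]
      exact integral_inner_inCoordinates)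
  rw [lintegral_eigenvalues_eq hV hVint, ← ENNReal.ofReal_mul (by positivity),
    ENNReal.ofReal_le_ofReal_iff (by positivity)] at h
  refine h.trans ?_
  gcongr
  exact pi_div_sqrt_three_le
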